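/- arXiv:2502.18876 — 2 statements merged into one kernel-verified Lean document; each statement's English description precedes it below -/
import Mathlib

section
/- Let n = 2. Every extreme point q = (q_1, q_2) of 𝒬 is uniquely rationalized: if measurable functions f, f̃ : [0,1]² → [0,1] (not necessarily monotone) both rationalize q, then f = f̃ almost everywhere with respect to Lebesgue measure on [0,1]². -/
open MeasureTheory

noncomputable section

/-- The closed unit square `[0,1]²`. -/
def unitSq : Set (ℝ × ℝ) := Set.Icc 0 1

/-- `q : [0,1] → [0,1]` is nondecreasing and left-continuous. -/
def MonoLC (q : ℝ → ℝ) : Prop :=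
  MonotoneOn q (Set.Icc 0 1) ∧
  (∀ t ∈ Set.Icc (0 : ℝ) 1, q t ∈ Set.Icc (0 : ℝ) 1) ∧
  ∀ t ∈ Set.Ioc (0 : ℝ) 1, Filter.Tendsto q (nhdsWithin t (Set.Iio t)) (nhds (q t))

/-- `f : [0,1]² → [0,1]` rationalizes the pair `(q₁, q₂)`: the `qᵢ` are (a.e.) the
one-dimensional marginals of `f`. -/
def Rat2 (f : ℝ × ℝ → ℝ) (q₁ q₂ : ℝ → ℝ) : Prop :=
  AEMeasurable f (volume.restrict unitSq) ∧
  (∀ x ∈ unitSq, f x ∈ Set.Icc (0 : ℝ) 1) ∧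
  (∀ᵐ t ∂(volume.restrict (Set.Icc (0 : ℝ) 1)),
    q₁ t = ∫ y in Set.Icc (0 : ℝ) 1, f (t, y)) ∧
  (∀ᵐ t ∂(volume.restrict (Set.Icc (0 : ℝ) 1)),
    q₂ t = ∫ y in Set.Icc (0 : ℝ) 1, f (y, t))

/-- The set `𝒬` of rationalizable pairs of nondecreasing left-continuous functions. -/
def Q2 : Set ((ℝ → ℝ) × (ℝ → ℝ)) :=
  {q | MonoLC q.1 ∧ MonoLC q.2 ∧ ∃ f, Rat2 f q.1 q.2}

/-- `A` is an up-set of the square `[0,1]²`. -/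
def UpSet2 (A : Set (ℝ × ℝ)) : Prop :=
  A ⊆ unitSq ∧ ∀ x ∈ A, ∀ y ∈ unitSq, x ≤ y → y ∈ A

/-- `q` is an extreme point of a set `S` of pairs of functions on `[0,1]`, with
componentwise convex combinations (only the values on `[0,1]` matter). -/
def ExtremePt2 (S : Set ((ℝ → ℝ) × (ℝ → ℝ))) (q : (ℝ → ℝ) × (ℝ → ℝ)) : Prop :=
  q ∈ S ∧ ∀ q' ∈ S, ∀ q'' ∈ S, ∀ l : ℝ, 0 < l → l < 1 →
    (∀ t ∈ Set.Icc (0 : ℝ) 1,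
      q.1 t = l * q'.1 t + (1 - l) * q''.1 t ∧
      q.2 t = l * q'.2 t + (1 - l) * q''.2 t) →
    ∀ t ∈ Set.Icc (0 : ℝ) 1, q'.1 t = q''.1 t ∧ q'.2 t = q''.2 t

section Marginals

universe u

variable {α β : Type u} [MeasurableSpace α] [MeasurableSpace β]

/-- `f` is a measurable `[0,1]`-valued function on a product space with marginals `a` and `b`. -/
def HasMarginals (μ : Measure α) (ν : Measure β) (f : α × β → ℝ) (a : α → ℝ) (b : β → ℝ) : Prop :=
  Measurable f ∧ (∀ p, f p ∈ Set.Icc (0 : ℝ) 1) ∧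
  (a =ᵐ[μ] fun x => ∫ y, f (x, y) ∂ν) ∧ (b =ᵐ[ν] fun y => ∫ x, f (x, y) ∂μ)

/-- `g` satisfies the variational inequality characterizing the function of least `L²` norm
among those with marginals `a` and `b`. -/
def IsLeastNorm (μ : Measure α) (ν : Measure β) (g : α × β → ℝ) (a : α → ℝ) (b : β → ℝ) : Prop :=
  HasMarginals μ ν g a b ∧
    ∀ w, HasMarginals μ ν w a b → 0 ≤ ∫ p, g p * (w p - g p) ∂(μ.prod ν)

theorem integrable_of_mem_Icc {γ : Type*} [MeasurableSpace γ] {μ : Measure γ} [IsFiniteMeasure μ]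
    {f : γ → ℝ} (hf : AEStronglyMeasurable f μ) {l u : ℝ} (h : ∀ p, f p ∈ Set.Icc l u) :
    Integrable f μ :=
  Integrable.of_mem_Icc l u hf.aemeasurable (Filter.Eventually.of_forall h)

variable {μ : Measure α} {ν : Measure β} {f g : α × β → ℝ} {a : α → ℝ} {b : β → ℝ}

theorem HasMarginals.swap (hf : HasMarginals μ ν f a b) :
    HasMarginals ν μ (fun p => f p.swap) b a :=
  ⟨hf.1.comp measurable_swap, fun p => hf.2.1 p.swap, hf.2.2.2, hf.2.2.1⟩

variable [IsProbabilityMeasure μ] [IsProbabilityMeasure ν]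

theorem HasMarginals.integrable (hf : HasMarginals μ ν f a b) : Integrable f (μ.prod ν) :=
  integrable_of_mem_Icc hf.1.aestronglyMeasurable hf.2.1

theorem IsLeastNorm.swap (hg : IsLeastNorm μ ν g a b) :
    IsLeastNorm ν μ (fun p => g p.swap) b a := by
  refine ⟨hg.1.swap, fun w hw => ?_⟩
  have := hg.2 _ hw.swap
  rw [← integral_prod_swap] at this
  simpa using this

theorem HasMarginals.setIntegral_left (hf : HasMarginals μ ν f a b) {S : Set α}
    (hS : MeasurableSet S) : ∫ p in S ×ˢ Set.univ, f p ∂(μ.prod ν) = ∫ x in S, a x ∂μ := by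
  rw [setIntegral_prod _ hf.integrable.integrableOn]
  refine setIntegral_congr_ae hS ?_
  filter_upwards [hf.2.2.1] with x hx _
  simp [hx]

theorem HasMarginals.setIntegral_right (hf : HasMarginals μ ν f a b) {T : Set β}
    (hT : MeasurableSet T) : ∫ p in Set.univ ×ˢ T, f p ∂(μ.prod ν) = ∫ y in T, b y ∂ν := by
  rw [← hf.swap.setIntegral_left hT, setIntegral_prod_swap]

theorem HasMarginals.integrable_left (hf : HasMarginals μ ν f a b) : Integrable a μ :=
  hf.integrable.integral_prod_left.congr hf.2.2.1.symm

theorem ae_eq_marginal_of_setIntegral_eq {f : α × β → ℝ} (hf : Integrable f (μ.prod ν))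
    (ha : Integrable a μ)
    (h : ∀ S, MeasurableSet S →
      ∫ p in S ×ˢ Set.univ, f p ∂(μ.prod ν) = ∫ x in S, a x ∂μ) :
    a =ᵐ[μ] fun x => ∫ y, f (x, y) ∂ν := by
  refine Integrable.ae_eq_of_forall_setIntegral_eq _ _ ha hf.integral_prod_left fun S hS _ => ?_
  rw [← h S hS, setIntegral_prod _ hf.integrableOn]
  simp

theorem HasMarginals.exists_isLeastNorm (hf : HasMarginals μ ν f a b) :
    ∃ g, IsLeastNorm μ ν g a b := by
  have memLp : ∀ w, HasMarginals μ ν w a b → MemLp w 2 (μ.prod ν) := fun w hw =>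
    MemLp.of_bound hw.1.aestronglyMeasurable 1 (Filter.Eventually.of_forall fun p => by
      rw [Real.norm_eq_abs, abs_le]; constructor <;> linarith [(hw.2.1 p).1, (hw.2.1 p).2])
  have cont : ∀ E, MeasurableSet E →
      Continuous fun u : Lp ℝ 2 (μ.prod ν) => ∫ p in E, u p ∂(μ.prod ν) := fun E hE => by
    simp_rw [← L2.inner_indicatorConstLp_one (𝕜 := ℝ) hE (measure_ne_top _ _)]
    fun_prop
  have int : ∀ u : Lp ℝ 2 (μ.prod ν), Integrable u (μ.prod ν) := fun u =>
    (Lp.memLp u).integrable (by norm_num)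
  have comb : ∀ E, ∀ u v : Lp ℝ 2 (μ.prod ν), ∀ s t : ℝ,
      ∫ p in E, (s • u + t • v : Lp ℝ 2 (μ.prod ν)) p ∂(μ.prod ν)
        = s * ∫ p in E, u p ∂(μ.prod ν) + t * ∫ p in E, v p ∂(μ.prod ν) := fun E u v s t => by
    rw [← integral_const_mul, ← integral_const_mul, ← integral_add
      ((int u).integrableOn.const_mul s) ((int v).integrableOn.const_mul t)]
    refine integral_congr_ae (ae_restrict_of_ae ?_)
    filter_upwards [Lp.coeFn_add (s • u) (t • v), Lp.coeFn_smul s u, Lp.coeFn_smul t v]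
      with p h1 h2 h3
    rw [h1, Pi.add_apply, h2, h3]
    rfl
  let K : Set (Lp ℝ 2 (μ.prod ν)) := {u |
    (∀ E, MeasurableSet E → ∫ p in E, u p ∂(μ.prod ν) ∈ Set.Icc 0 ((μ.prod ν).real E)) ∧
    (∀ S, MeasurableSet S → ∫ p in S ×ˢ Set.univ, u p ∂(μ.prod ν) = ∫ x in S, a x ∂μ) ∧
    (∀ T, MeasurableSet T → ∫ p in Set.univ ×ˢ T, u p ∂(μ.prod ν) = ∫ y in T, b y ∂ν)}
  have memK : ∀ w (hw : HasMarginals μ ν w a b), (memLp w hw).toLp w ∈ K := fun w hw => by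
    have e : ∀ E, ∫ p in E, (memLp w hw).toLp w p ∂(μ.prod ν) = ∫ p in E, w p ∂(μ.prod ν) :=
      fun E => integral_congr_ae (ae_restrict_of_ae (memLp w hw).coeFn_toLp)
    refine ⟨fun E hE => ?_, fun S hS => ?_, fun T hT => ?_⟩
    · rw [e]
      refine ⟨setIntegral_nonneg hE fun p _ => (hw.2.1 p).1, ?_⟩
      calc ∫ p in E, w p ∂(μ.prod ν) ≤ ∫ p in E, (1 : ℝ) ∂(μ.prod ν) :=
            setIntegral_mono hw.integrable.integrableOn (integrable_const _).integrableOn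
              fun p => (hw.2.1 p).2
        _ = _ := by simp
    · rw [e, hw.setIntegral_left hS]
    · rw [e, hw.setIntegral_right hT]
  have closed : IsClosed K := by
    refine IsClosed.and ?_ (IsClosed.and ?_ ?_) <;>
      simp only [Set.ofPred_forall] <;>
      refine isClosed_iInter fun E => isClosed_iInter fun hE => ?_
    · exact isClosed_Icc.preimage (cont E hE)
    · exact isClosed_eq (cont _ (hE.prod MeasurableSet.univ)) continuous_const
    · exact isClosed_eq (cont _ (MeasurableSet.univ.prod hE)) continuous_const
  have conv : Convex ℝ K := by
    intro u hu v hv s t hs ht hst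
    refine ⟨fun E hE => ?_, fun S hS => ?_, fun T hT => ?_⟩ <;> rw [comb]
    · exact (convex_Icc _ _) (hu.1 E hE) (hv.1 E hE) hs ht hst
    · rw [hu.2.1 S hS, hv.2.1 S hS, ← add_mul, hst, one_mul]
    · rw [hu.2.2 T hT, hv.2.2 T hT, ← add_mul, hst, one_mul]
  obtain ⟨v, hv, hmin⟩ := exists_norm_eq_iInf_of_complete_convex ⟨_, memK f hf⟩
    closed.isComplete conv 0
  rw [norm_eq_iInf_iff_real_inner_le_zero conv hv] at hmin
  have v0 : 0 ≤ᵐ[μ.prod ν] v :=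
    ae_nonneg_of_forall_setIntegral_nonneg (int v) fun E hE _ => (hv.1 E hE).1
  have v1 : v ≤ᵐ[μ.prod ν] fun _ => (1 : ℝ) :=
    ae_le_of_forall_setIntegral_le (int v) (integrable_const _) fun E hE _ => by
      simpa using (hv.1 E hE).2
  have vm : Measurable v := (Lp.stronglyMeasurable v).measurable
  let g : α × β → ℝ := fun p => max 0 (min 1 (v p))
  have gv : v =ᵐ[μ.prod ν] g := by
    filter_upwards [v0, v1] with p h0 h1
    simp only [g]
    rw [min_eq_right h1]
    exact (max_eq_right h0).symm
  have gm : Measurable g := measurable_const.max (measurable_const.min vm)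
  have gI : ∀ p, g p ∈ Set.Icc (0 : ℝ) 1 := fun p =>
    ⟨le_max_left _ _, max_le zero_le_one (min_le_left _ _)⟩
  have gint : Integrable g (μ.prod ν) := integrable_of_mem_Icc gm.aestronglyMeasurable gI
  have e : ∀ E, ∫ p in E, v p ∂(μ.prod ν) = ∫ p in E, g p ∂(μ.prod ν) :=
    fun E => integral_congr_ae (ae_restrict_of_ae gv)
  refine ⟨g, ⟨gm, gI, ?_, ?_⟩, fun w hw => ?_⟩
  · exact ae_eq_marginal_of_setIntegral_eq gint hf.integrable_left fun S hS => by
      rw [← e, hv.2.1 S hS]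
  · exact ae_eq_marginal_of_setIntegral_eq (f := fun p : β × α => g p.swap) gint.swap
      hf.swap.integrable_left fun T hT => by
        rw [setIntegral_prod_swap Set.univ T g, ← e, hv.2.2 T hT]
  · have h := hmin _ (memK w hw)
    rw [zero_sub, inner_neg_left, neg_nonpos, L2.inner_def] at h
    refine h.trans_eq (integral_congr_ae ?_)
    filter_upwards [gv, (memLp w hw).coeFn_toLp, Lp.coeFn_sub ((memLp w hw).toLp w) v]
      with p h1 h2 h3
    rw [h3, Pi.sub_apply, h2, h1]
    exact mul_comm _ _

theorem IsLeastNorm.ae_le_of_marginal_le (hg : IsLeastNorm μ ν g a b) :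
    ∀ᵐ p ∂(μ.prod μ), a p.1 ≤ a p.2 → ∀ᵐ y ∂ν, g (p.1, y) ≤ g (p.2, y) := by
  obtain ⟨⟨gm, gI, ga, gb⟩, hmin⟩ := hg
  let d : (α × α) × β → ℝ := fun z => g (z.1.1, z.2) - g (z.1.2, z.2)
  have dm : Measurable d := by fun_prop
  let u : (α × α) × β → ℝ := fun z => max (d z) 0
  let v : (α × α) × β → ℝ := fun z => max (-d z) 0
  have um : Measurable u := by fun_prop
  have vm : Measurable v := by fun_prop
  have u_le : ∀ z, u z ≤ g (z.1.1, z.2) ∧ u z ≤ 1 - g (z.1.2, z.2) := fun z =>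
    ⟨max_le (by linarith [(gI (z.1.2, z.2)).1]) (gI _).1,
      max_le (by linarith [(gI (z.1.1, z.2)).2]) (by linarith [(gI (z.1.2, z.2)).2])⟩
  have v_le : ∀ z, v z ≤ g (z.1.2, z.2) ∧ v z ≤ 1 - g (z.1.1, z.2) := fun z =>
    ⟨max_le (by linarith [(gI (z.1.1, z.2)).1]) (gI _).1,
      max_le (by linarith [(gI (z.1.2, z.2)).2]) (by linarith [(gI (z.1.1, z.2)).2])⟩
  have uI : ∀ z, u z ∈ Set.Icc (0 : ℝ) 1 := fun z =>
    ⟨le_max_right _ _, (u_le z).1.trans (gI _).2⟩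
  have vI : ∀ z, v z ∈ Set.Icc (0 : ℝ) 1 := fun z =>
    ⟨le_max_right _ _, (v_le z).1.trans (gI _).2⟩
  have swap_u : ∀ p y, u (Prod.swap p, y) = v (p, y) := fun p y => by simp [u, v, d]
  have swap_v : ∀ p y, v (Prod.swap p, y) = u (p, y) := fun p y => by simp [u, v, d]
  have ui : ∀ p, Integrable (fun y => u (p, y)) ν := fun p =>
    integrable_of_mem_Icc (um.comp measurable_prodMk_left).aestronglyMeasurable fun y => uI _
  have vi : ∀ p, Integrable (fun y => v (p, y)) ν := fun p =>
    integrable_of_mem_Icc (vm.comp measurable_prodMk_left).aestronglyMeasurable fun y => vI _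
  let P : α × α → ℝ := fun p => ∫ y, u (p, y) ∂ν
  let N : α × α → ℝ := fun p => ∫ y, v (p, y) ∂ν
  have Pm : Measurable P := (um.stronglyMeasurable.integral_prod_right' (ν := ν)).measurable
  have Nm : Measurable N := (vm.stronglyMeasurable.integral_prod_right' (ν := ν)).measurable
  have intI : ∀ k : β → ℝ, Integrable k ν → (∀ y, k y ∈ Set.Icc (0 : ℝ) 1) →
      ∫ y, k y ∂ν ∈ Set.Icc (0 : ℝ) 1 := fun k hk hkI => by
    refine ⟨integral_nonneg fun y => (hkI y).1, ?_⟩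
    simpa using integral_mono hk (integrable_const (1 : ℝ)) fun y => (hkI y).2
  have PI : ∀ p, P p ∈ Set.Icc (0 : ℝ) 1 := fun p => intI _ (ui p) fun y => uI _
  have NI : ∀ p, N p ∈ Set.Icc (0 : ℝ) 1 := fun p => intI _ (vi p) fun y => vI _
  let h : (α × α) × β → ℝ := fun z => N z.1 * u z - P z.1 * v z
  have hm : Measurable h := by fun_prop
  have h_le : ∀ z, h z ≤ g (z.1.1, z.2) := fun z => by
    have := mul_le_of_le_one_left (uI z).1 (NI z.1).2
    have := mul_nonneg (PI z.1).1 (vI z).1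
    have := (u_le z).1
    simp only [h]; linarith
  have le_h : ∀ z, -(1 - g (z.1.1, z.2)) ≤ h z := fun z => by
    have := mul_le_of_le_one_left (vI z).1 (PI z.1).2
    have := mul_nonneg (NI z.1).1 (uI z).1
    have := (v_le z).2
    simp only [h]; linarith
  have hI : ∀ z, h z ∈ Set.Icc (-1 : ℝ) 1 := fun z =>
    ⟨by linarith [le_h z, (gI (z.1.1, z.2)).1], (h_le z).trans (gI _).2⟩
  have swap_h : ∀ p y, h (Prod.swap p, y) = -h (p, y) := fun p y => by
    simp only [h, P, N, swap_u, swap_v]; ring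
  have hi : ∀ {γ : Type u} [MeasurableSpace γ] (ρ : Measure γ) [IsFiniteMeasure ρ]
      (k : γ → (α × α) × β), Measurable k → Integrable (fun c => h (k c)) ρ := fun ρ _ k hk =>
    integrable_of_mem_Icc (hm.comp hk).aestronglyMeasurable fun c => hI _
  have ghi : ∀ {γ : Type u} [MeasurableSpace γ] (ρ : Measure γ) [IsFiniteMeasure ρ]
      (k : γ → (α × α) × β) (l : γ → α × β), Measurable k → Measurable l →
      Integrable (fun c => g (l c) * h (k c)) ρ := fun ρ _ k l hk hl =>
    integrable_of_mem_Icc (l := -1) (u := 1)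
      ((gm.comp hl).mul (hm.comp hk)).aestronglyMeasurable fun c => by
        have h1 := hI (k c); have h2 := gI (l c)
        constructor <;> nlinarith [h1.1, h1.2, h2.1, h2.2]
  let w : α × β → ℝ := fun q => g q - ∫ x', h ((q.1, x'), q.2) ∂μ
  have wm : Measurable w := by
    refine gm.sub (StronglyMeasurable.measurable ?_)
    exact StronglyMeasurable.integral_prod_right (ν := μ)
      (f := fun (q : α × β) x' => h ((q.1, x'), q.2))
      (Measurable.stronglyMeasurable (by fun_prop))
  have wI : ∀ q, w q ∈ Set.Icc (0 : ℝ) 1 := fun q => by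
    have i1 : Integrable (fun x' => h ((q.1, x'), q.2)) μ := hi μ _ (by fun_prop)
    have h1 := integral_mono i1 (integrable_const (g q)) fun x' => h_le ((q.1, x'), q.2)
    have h2 := integral_mono (integrable_const (-(1 - g q))) i1 fun x' => le_h ((q.1, x'), q.2)
    simp only [integral_const, probReal_univ, one_smul] at h1 h2
    constructor <;> simp only [w] <;> linarith
  have h_right : ∀ p, ∫ y, h (p, y) ∂ν = 0 := fun p => by
    simp only [h]
    rw [integral_sub ((ui p).const_mul _) ((vi p).const_mul _), integral_const_mul,
      integral_const_mul]
    simp only [P, N]; ring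
  have h_left : ∀ y, ∫ p, h (p, y) ∂(μ.prod μ) = 0 := fun y => by
    have := integral_prod_swap (μ := μ) (ν := μ) fun p => h (p, y)
    simp only [swap_h, integral_neg] at this
    linarith
  have gr : ∀ x, Integrable (fun y => g (x, y)) ν := fun x =>
    integrable_of_mem_Icc (gm.comp measurable_prodMk_left).aestronglyMeasurable fun y => gI _
  have gl : ∀ y, Integrable (fun x => g (x, y)) μ := fun y =>
    integrable_of_mem_Icc (gm.comp measurable_prodMk_right).aestronglyMeasurable fun x => gI _
  have wa : a =ᵐ[μ] fun x => ∫ y, w (x, y) ∂ν := by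
    filter_upwards [ga] with x hx
    simp only [w]
    have h1 : Integrable (fun q : β × α => h ((x, q.2), q.1)) (ν.prod μ) := hi _ _ (by fun_prop)
    rw [integral_sub (gr x) h1.integral_prod_left, hx,
      integral_integral_swap (f := fun y x' => h ((x, x'), y)) h1]
    simp [h_right]
  have wb : b =ᵐ[ν] fun y => ∫ x, w (x, y) ∂μ := by
    filter_upwards [gb] with y hy
    simp only [w]
    have h1 : Integrable (fun p => h (p, y)) (μ.prod μ) := hi _ _ (by fun_prop)
    rw [integral_sub (gl y) h1.integral_prod_left, hy, ← integral_prod _ h1, h_left, sub_zero]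
  have key := hmin w ⟨wm, wI, wa, wb⟩
  have J : ∫ q, g q * (w q - g q) ∂(μ.prod ν)
      = -∫ y, ∫ p, g (p.1, y) * h (p, y) ∂(μ.prod μ) ∂ν := by
    have e : ∀ q, g q * (w q - g q) = -∫ x', g q * h ((q.1, x'), q.2) ∂μ := fun q => by
      rw [integral_const_mul]; simp only [w]; ring
    simp only [e, integral_neg]
    rw [integral_prod_symm]
    · congr 1
      refine integral_congr_ae (Filter.Eventually.of_forall fun y => ?_)
      exact (integral_prod (fun p : α × α => g (p.1, y) * h (p, y))
        (ghi _ (fun p => (p, y)) (fun p => (p.1, y)) (by fun_prop) (by fun_prop))).symm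
    · exact Integrable.integral_prod_left
        (f := fun z : (α × β) × α => g z.1 * h ((z.1.1, z.2), z.1.2))
        (ghi _ _ Prod.fst (by fun_prop) (by fun_prop))
  have J' : ∀ y, ∫ p, d (p, y) * h (p, y) ∂(μ.prod μ)
      = 2 * ∫ p, g (p.1, y) * h (p, y) ∂(μ.prod μ) := fun y => by
    have i1 := ghi (μ.prod μ) (fun p => (p, y)) (fun p => (p.1, y)) (by fun_prop) (by fun_prop)
    have i2 := ghi (μ.prod μ) (fun p => (p, y)) (fun p => (p.2, y)) (by fun_prop) (by fun_prop)
    have := integral_prod_swap (μ := μ) (ν := μ) fun p => g (p.1, y) * h (p, y)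
    simp only [swap_h, Prod.fst_swap, mul_neg, integral_neg] at this
    simp only [d, sub_mul]
    rw [integral_sub i1 i2]
    linarith
  have dh : ∀ z, d z * h z = N z.1 * u z ^ 2 + P z.1 * v z ^ 2 := fun z => by
    simp only [h]
    rcases le_total (d z) 0 with hd | hd
    · rw [show u z = 0 from max_eq_right hd, show v z = -d z from max_eq_left (by linarith)]; ring
    · rw [show u z = d z from max_eq_left hd, show v z = 0 from max_eq_right (by linarith)]; ring
  have dh0 : ∀ z, 0 ≤ d z * h z := fun z => by
    rw [dh]
    exact add_nonneg (mul_nonneg (NI _).1 (sq_nonneg _)) (mul_nonneg (PI _).1 (sq_nonneg _))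
  have dhi : Integrable (fun z => d z * h z) ((μ.prod μ).prod ν) := by
    simp only [d, sub_mul]
    exact (ghi _ _ _ (by fun_prop) (by fun_prop)).sub (ghi _ _ _ (by fun_prop) (by fun_prop))
  have zero : ∫ z, d z * h z ∂((μ.prod μ).prod ν) = 0 := by
    refine le_antisymm ?_ (integral_nonneg dh0)
    rw [integral_prod_symm _ dhi]
    simp only [J', integral_const_mul]
    rw [J] at key
    linarith
  rw [integral_eq_zero_iff_of_nonneg dh0 dhi] at zero
  have ga' : ∀ᵐ p ∂(μ.prod μ), a p.1 = ∫ y, g (p.1, y) ∂ν ∧ a p.2 = ∫ y, g (p.2, y) ∂ν :=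
    (Measure.quasiMeasurePreserving_fst.ae ga).and (Measure.quasiMeasurePreserving_snd.ae ga)
  filter_upwards [Measure.ae_ae_of_ae_prod zero, ga'] with p hp ⟨h1, h2⟩ hle
  have PN : P p - N p = a p.1 - a p.2 := by
    rw [h1, h2, ← integral_sub (gr _) (gr _), ← integral_sub (ui p) (vi p)]
    refine integral_congr_ae (Filter.Eventually.of_forall fun y => ?_)
    exact max_zero_sub_max_neg_zero_eq_self _
  have u0 : ∀ᵐ y ∂ν, u (p, y) = 0 := by
    rcases (PI p).1.eq_or_lt with h0 | h0
    · exact (integral_eq_zero_iff_of_nonneg (fun y => (uI _).1) (ui p)).1 h0.symm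
    · filter_upwards [hp] with y hy
      rw [dh] at hy
      have hN : 0 < N p := by linarith
      have : 0 ≤ P p * v (p, y) ^ 2 := mul_nonneg (PI _).1 (sq_nonneg _)
      have : 0 ≤ N p * u (p, y) ^ 2 := mul_nonneg (NI _).1 (sq_nonneg _)
      have hz : N p * u (p, y) ^ 2 = 0 := by
        simp only [Pi.zero_apply] at hy; linarith
      simpa [hN.ne'] using hz
  filter_upwards [u0] with y hy
  have : d (p, y) ≤ u (p, y) := le_max_left _ _
  simp only [d] at this
  linarith

end Marginals

/-- Lebesgue measure on `[0,1]`. -/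
abbrev unitMeasure : Measure ℝ := volume.restrict (Set.Icc (0 : ℝ) 1)

instance : IsProbabilityMeasure unitMeasure :=
  ⟨by simp [unitMeasure]⟩

theorem exists_mem_Ioo_of_ae {p : ℝ → Prop} (hp : ∀ᵐ x ∂unitMeasure, p x) {s t : ℝ}
    (hs : 0 ≤ s) (ht : t ≤ 1) (hst : s < t) : ∃ x ∈ Set.Ioo s t, p x := by
  rw [ae_restrict_iff' measurableSet_Icc] at hp
  obtain ⟨x, hx, h1, h2⟩ := (Measure.dense_of_ae hp).exists_between hst
  exact ⟨x, ⟨h1, h2⟩, hx ⟨by linarith, by linarith⟩⟩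

theorem exists_monoLC_ae_eq {m : ℝ → ℝ} (hI : ∀ x, m x ∈ Set.Icc (0 : ℝ) 1)
    (h : ∀ᵐ p ∂(unitMeasure.prod unitMeasure), p.1 ≤ p.2 → m p.1 ≤ m p.2) :
    ∃ r, MonoLC r ∧ r =ᵐ[unitMeasure] m := by
  have h' : ∀ᵐ p ∂(unitMeasure.prod unitMeasure), p.2 ≤ p.1 → m p.2 ≤ m p.1 :=
    Measure.measurePreserving_swap.quasiMeasurePreserving.ae h
  let G : Set ℝ := {x | (∀ᵐ x' ∂unitMeasure, x ≤ x' → m x ≤ m x') ∧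
    (∀ᵐ x' ∂unitMeasure, x' ≤ x → m x' ≤ m x) ∧ x ∈ Set.Icc (0 : ℝ) 1}
  have hG : ∀ᵐ x ∂unitMeasure, x ∈ G := by
    filter_upwards [Measure.ae_ae_of_ae_prod h, Measure.ae_ae_of_ae_prod h',
      ae_restrict_mem measurableSet_Icc] with x h1 h2 h3 using ⟨h1, h2, h3⟩
  have mono : MonotoneOn m G := by
    intro x hx y hy hxy
    rcases hxy.eq_or_lt with rfl | hlt
    · rfl
    obtain ⟨z, hz, h1, h2⟩ := exists_mem_Ioo_of_ae (hx.1.and hy.2.1) hx.2.2.1 hy.2.2.2 hlt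
    exact (h1 hz.1.le).trans (h2 hz.2.le)
  obtain ⟨k, kmono, hk⟩ := mono.exists_monotone_extension
    ⟨0, by rintro _ ⟨x, -, rfl⟩; exact (hI x).1⟩ ⟨1, by rintro _ ⟨x, -, rfl⟩; exact (hI x).2⟩
  refine ⟨fun x => max 0 (min 1 (Function.leftLim k x)), ⟨?_, ?_, ?_⟩, ?_⟩
  · intro x _ y _ hxy
    exact max_le_max le_rfl (min_le_min le_rfl (kmono.leftLim hxy))
  · exact fun x _ => ⟨le_max_left _ _, max_le zero_le_one (min_le_left _ _)⟩
  · intro x _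
    have hc : Filter.Tendsto (Function.leftLim k) (nhdsWithin x (Set.Iio x))
        (nhds (Function.leftLim k x)) :=
      (continuousWithinAt_leftLim_Iic (kmono.tendsto_leftLim x)).mono_left
        (nhdsWithin_mono _ Set.Iio_subset_Iic_self)
    exact tendsto_const_nhds.max (tendsto_const_nhds.min hc)
  · have hc : ∀ᵐ x ∂unitMeasure, ContinuousAt k x :=
      ae_restrict_of_ae (kmono.countable_not_continuousAt.ae_notMem volume |>.mono
        fun x hx => by simpa using hx)
    filter_upwards [hG, hc] with x hx hcx
    rw [hcx.continuousWithinAt.leftLim_eq, ← hk hx, min_eq_right (hI x).2, max_eq_right (hI x).1]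

theorem eq_of_tendsto_of_ae_eq {p r : ℝ → ℝ} (h : p =ᵐ[unitMeasure] r) {t : ℝ}
    (ht : t ∈ Set.Ioc (0 : ℝ) 1)
    (hp : Filter.Tendsto p (nhdsWithin t (Set.Iio t)) (nhds (p t)))
    (hr : Filter.Tendsto r (nhdsWithin t (Set.Iio t)) (nhds (r t))) : p t = r t := by
  by_contra hne
  obtain ⟨s, hs, hsub⟩ := mem_nhdsLT_iff_exists_Ioo_subset.1
    ((hp.sub hr).eventually_ne (sub_ne_zero.2 hne))
  obtain ⟨x, hx, hxe⟩ := exists_mem_Ioo_of_ae h (le_max_right s 0) ht.2 (max_lt hs ht.1)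
  exact hsub ⟨(le_max_left _ _).trans_lt hx.1, hx.2⟩ (sub_eq_zero.2 hxe)

theorem MonoLC.update_zero {p : ℝ → ℝ} (hp : MonoLC p) {c : ℝ} (h0 : 0 ≤ c)
    (hc : ∀ t ∈ Set.Ioc (0 : ℝ) 1, c ≤ p t) : MonoLC (Function.update p 0 c) := by
  have e : ∀ t, 0 < t → Function.update p 0 c t = p t := fun t ht =>
    Function.update_of_ne ht.ne' _ _
  refine ⟨fun x hx y hy hxy => ?_, fun t ht => ?_, fun t ht => ?_⟩
  · rcases hx.1.eq_or_lt with rfl | hx0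
    · rcases hy.1.eq_or_lt with rfl | hy0
      · rfl
      · rw [e y hy0, Function.update_self]; exact hc y ⟨hy0, hy.2⟩
    · rw [e x hx0, e y (hx0.trans_le hxy)]; exact hp.1 hx hy hxy
  · rcases ht.1.eq_or_lt with rfl | h
    · rw [Function.update_self]
      exact ⟨h0, (hc 1 (by simp)).trans (hp.2.1 1 (by simp)).2⟩
    · rw [e t h]; exact hp.2.1 t ht
  · rw [e t ht.1]
    refine (hp.2.2 t ht).congr' ?_
    filter_upwards [nhdsWithin_le_nhds (Ioi_mem_nhds ht.1)] with x hx using (e x hx).symm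

theorem update_zero_ae_eq (p : ℝ → ℝ) (c : ℝ) : Function.update p 0 c =ᵐ[unitMeasure] p := by
  filter_upwards [ae_restrict_of_ae (Measure.ae_ne volume (0 : ℝ))] with x hx
  exact Function.update_of_ne hx _ _

theorem MonoLC.exists_midpoint {p p₁ p₂ : ℝ → ℝ} (hp : MonoLC p) (hp₁ : MonoLC p₁)
    (hp₂ : MonoLC p₂) (h : ∀ᵐ x ∂unitMeasure, 2 * p x = p₁ x + p₂ x) :
    ∃ r₁ r₂, MonoLC r₁ ∧ MonoLC r₂ ∧ r₁ =ᵐ[unitMeasure] p₁ ∧ r₂ =ᵐ[unitMeasure] p₂ ∧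
      ∀ t ∈ Set.Icc (0 : ℝ) 1, p t = 1 / 2 * r₁ t + (1 - 1 / 2) * r₂ t := by
  have hpos : ∀ t ∈ Set.Ioc (0 : ℝ) 1, 2 * p t = p₁ t + p₂ t := fun t ht =>
    eq_of_tendsto_of_ae_eq h ht ((hp.2.2 t ht).const_mul 2) ((hp₁.2.2 t ht).add (hp₂.2.2 t ht))
  have h01 : (0 : ℝ) ∈ Set.Icc (0 : ℝ) 1 := by simp
  have hle : ∀ s ∈ Set.Ioc (0 : ℝ) 1, ∀ t ∈ Set.Ioc (0 : ℝ) 1, 2 * p 0 ≤ p₁ s + p₂ t := by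
    intro s hs t ht
    have hm : min s t ∈ Set.Ioc (0 : ℝ) 1 := ⟨lt_min hs.1 ht.1, (min_le_left _ _).trans hs.2⟩
    have hm' := Set.Ioc_subset_Icc_self hm
    have h1 := hp.1 h01 hm' hm'.1
    have h2 := hp₁.1 hm' (Set.Ioc_subset_Icc_self hs) (min_le_left _ _)
    have h3 := hp₂.1 hm' (Set.Ioc_subset_Icc_self ht) (min_le_right _ _)
    linarith [hpos _ hm]
  have hbdd : BddBelow (p₁ '' Set.Ioc 0 1) :=
    ⟨0, by rintro _ ⟨x, hx, rfl⟩; exact (hp₁.2.1 x (Set.Ioc_subset_Icc_self hx)).1⟩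
  have hne : (p₁ '' Set.Ioc (0 : ℝ) 1).Nonempty := ⟨_, 1, by simp, rfl⟩
  have hp0 := (hp.2.1 0 h01).1
  set i := sInf (p₁ '' Set.Ioc (0 : ℝ) 1) with hi
  have i0 : 0 ≤ i := le_csInf hne (by
    rintro _ ⟨x, hx, rfl⟩; exact (hp₁.2.1 x (Set.Ioc_subset_Icc_self hx)).1)
  refine ⟨Function.update p₁ 0 (min i (2 * p 0)),
    Function.update p₂ 0 (2 * p 0 - min i (2 * p 0)),
    hp₁.update_zero (le_min i0 (by linarith))
      fun t ht => (min_le_left _ _).trans (csInf_le hbdd ⟨t, ht, rfl⟩),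
    hp₂.update_zero (sub_nonneg.2 (min_le_right _ _)) fun t ht => ?_,
    update_zero_ae_eq _ _, update_zero_ae_eq _ _, fun t ht => ?_⟩
  · rw [sub_le_comm]
    refine le_min (le_csInf hne ?_) (by linarith [(hp₂.2.1 t (Set.Ioc_subset_Icc_self ht)).1])
    rintro _ ⟨s, hs, rfl⟩
    linarith [hle s hs t ht]
  · rcases ht.1.eq_or_lt with rfl | h0
    · simp only [Function.update_self]; ring
    · rw [Function.update_of_ne h0.ne', Function.update_of_ne h0.ne']
      linarith [hpos t ⟨h0, ht.2⟩]

theorem ae_integral_of_ae_mono {k : ℝ → ℝ} (km : Measurable k)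
    (kI : ∀ y, k y ∈ Set.Icc (0 : ℝ) 1)
    (h : ∀ᵐ p ∂(unitMeasure.prod unitMeasure), p.1 ≤ p.2 → k p.1 ≤ k p.2) :
    ∀ᵐ y ∂unitMeasure, (k y = 1 → 1 - y ≤ ∫ t, k t ∂unitMeasure) ∧
      (k y = 0 → ∫ t, k t ∂unitMeasure ≤ 1 - y) := by
  have h' : ∀ᵐ p ∂(unitMeasure.prod unitMeasure), p.2 ≤ p.1 → k p.2 ≤ k p.1 :=
    Measure.measurePreserving_swap.quasiMeasurePreserving.ae h
  have ki : Integrable k unitMeasure := integrable_of_mem_Icc km.aestronglyMeasurable kI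
  have ind : ∀ y ∈ Set.Icc (0 : ℝ) 1,
      ∫ t, (Set.Ici y).indicator (fun _ => (1 : ℝ)) t ∂unitMeasure = 1 - y := fun y hy => by
    rw [integral_indicator measurableSet_Ici, unitMeasure,
      Measure.restrict_restrict measurableSet_Ici]
    have : Set.Ici y ∩ Set.Icc 0 1 = Set.Icc y 1 := by
      ext t; constructor
      · exact fun ht => ⟨ht.1, ht.2.2⟩
      · exact fun ht => ⟨ht.1, hy.1.trans ht.1, ht.2⟩
    simp [this, hy.2]
  have indi : ∀ y : ℝ, Integrable ((Set.Ici y).indicator fun _ => (1 : ℝ)) unitMeasure :=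
    fun y => (integrable_const _).indicator measurableSet_Ici
  filter_upwards [Measure.ae_ae_of_ae_prod h, Measure.ae_ae_of_ae_prod h',
    ae_restrict_mem measurableSet_Icc] with y h1 h2 hy
  refine ⟨fun hk => ?_, fun hk => ?_⟩ <;> rw [← ind y hy]
  · refine integral_mono_ae (indi y) ki ?_
    filter_upwards [h1] with t ht
    by_cases hyt : t ∈ Set.Ici y
    · rw [Set.indicator_of_mem hyt, ← hk]; exact ht hyt
    · rw [Set.indicator_of_notMem hyt]; exact (kI t).1
  · refine integral_mono_ae ki (indi y) ?_
    filter_upwards [h2] with t ht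
    by_cases hyt : t ∈ Set.Ici y
    · rw [Set.indicator_of_mem hyt]; exact (kI t).2
    · rw [Set.indicator_of_notMem hyt, ← hk]; exact ht (not_le.1 hyt).le

theorem prod_unitMeasure : unitMeasure.prod unitMeasure = volume.restrict unitSq := by
  rw [Measure.prod_restrict, Set.Icc_prod_Icc]
  rfl

theorem HasMarginals.rat2 {f : ℝ × ℝ → ℝ} {a b : ℝ → ℝ}
    (hf : HasMarginals unitMeasure unitMeasure f a b) : Rat2 f a b :=
  ⟨hf.1.aemeasurable, fun p _ => hf.2.1 p, hf.2.2.1, hf.2.2.2⟩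

theorem Rat2.exists_hasMarginals {f : ℝ × ℝ → ℝ} {a b : ℝ → ℝ} (hf : Rat2 f a b) :
    ∃ g, HasMarginals unitMeasure unitMeasure g a b ∧ f =ᵐ[unitMeasure.prod unitMeasure] g := by
  obtain ⟨fm, fI, fa, fb⟩ := hf
  rw [← prod_unitMeasure] at fm
  let g : ℝ × ℝ → ℝ := fun p => max 0 (min 1 (fm.mk f p))
  have fg : f =ᵐ[unitMeasure.prod unitMeasure] g := by
    have hmem : ∀ᵐ p ∂(unitMeasure.prod unitMeasure), p ∈ unitSq := by
      rw [prod_unitMeasure]; exact ae_restrict_mem measurableSet_Icc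
    filter_upwards [fm.ae_eq_mk, hmem] with p hp hpm
    simp only [g]
    rw [← hp, min_eq_right (fI p hpm).2, max_eq_right (fI p hpm).1]
  have fg' : ∀ᵐ p ∂(unitMeasure.prod unitMeasure), f p.swap = g p.swap :=
    Measure.measurePreserving_swap.quasiMeasurePreserving.ae fg
  refine ⟨g, ⟨measurable_const.max (measurable_const.min fm.measurable_mk), fun p =>
    ⟨le_max_left _ _, max_le zero_le_one (min_le_left _ _)⟩, ?_, ?_⟩, fg⟩
  · filter_upwards [fa, Measure.ae_ae_of_ae_prod fg] with x hx hxy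
    exact hx.trans (integral_congr_ae hxy)
  · filter_upwards [fb, Measure.ae_ae_of_ae_prod fg'] with x hx hxy
    exact hx.trans (integral_congr_ae hxy)

theorem IsLeastNorm.ae_mono {g : ℝ × ℝ → ℝ} {a b : ℝ → ℝ}
    (hg : IsLeastNorm unitMeasure unitMeasure g a b) (ha : MonoLC a) :
    ∀ᵐ p ∂(unitMeasure.prod unitMeasure), p.1 ≤ p.2 →
      ∀ᵐ y ∂unitMeasure, g (p.1, y) ≤ g (p.2, y) := by
  have hmem : ∀ᵐ x ∂unitMeasure, x ∈ Set.Icc (0 : ℝ) 1 := ae_restrict_mem measurableSet_Icc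
  have h1 : ∀ᵐ p ∂(unitMeasure.prod unitMeasure), p.1 ∈ Set.Icc (0 : ℝ) 1 :=
    Measure.quasiMeasurePreserving_fst.ae hmem
  have h2 : ∀ᵐ p ∂(unitMeasure.prod unitMeasure), p.2 ∈ Set.Icc (0 : ℝ) 1 :=
    Measure.quasiMeasurePreserving_snd.ae hmem
  filter_upwards [hg.ae_le_of_marginal_le, h1, h2] with p hp hp1 hp2 hle
  exact hp (ha.1 hp1 hp2 hle)

theorem IsLeastNorm.exists_monoLC_integral_comp {g : ℝ × ℝ → ℝ} {a b φ : ℝ → ℝ}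
    (hg : IsLeastNorm unitMeasure unitMeasure g a b) (ha : MonoLC a) (hφ : Monotone φ)
    (hφI : ∀ s ∈ Set.Icc (0 : ℝ) 1, φ s ∈ Set.Icc (0 : ℝ) 1) :
    ∃ r, MonoLC r ∧ r =ᵐ[unitMeasure] fun x => ∫ y, φ (g (x, y)) ∂unitMeasure := by
  have int : ∀ x, Integrable (fun y => φ (g (x, y))) unitMeasure := fun x =>
    integrable_of_mem_Icc
      (hφ.measurable.comp (hg.1.1.comp measurable_prodMk_left)).aestronglyMeasurable
      fun y => hφI _ (hg.1.2.1 _)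
  refine exists_monoLC_ae_eq (fun x => ⟨integral_nonneg fun y => (hφI _ (hg.1.2.1 _)).1, ?_⟩) ?_
  · simpa using integral_mono (int x) (integrable_const (1 : ℝ)) fun y => (hφI _ (hg.1.2.1 _)).2
  · filter_upwards [hg.ae_mono ha] with p hp hle
    refine integral_mono_ae (int _) (int _) ?_
    filter_upwards [hp hle] with y hy using hφ hy

theorem IsLeastNorm.exists_mem_Q2 {g : ℝ × ℝ → ℝ} {a b φ : ℝ → ℝ}
    (hg : IsLeastNorm unitMeasure unitMeasure g a b) (ha : MonoLC a) (hb : MonoLC b)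
    (hφ : Monotone φ) (hφI : ∀ s ∈ Set.Icc (0 : ℝ) 1, φ s ∈ Set.Icc (0 : ℝ) 1) :
    ∃ r₁ r₂, MonoLC r₁ ∧ MonoLC r₂ ∧
      HasMarginals unitMeasure unitMeasure (fun p => φ (g p)) r₁ r₂ := by
  obtain ⟨r₁, h₁, e₁⟩ := hg.exists_monoLC_integral_comp ha hφ hφI
  obtain ⟨r₂, h₂, e₂⟩ := hg.swap.exists_monoLC_integral_comp hb hφ hφI
  exact ⟨r₁, r₂, h₁, h₂, hφ.measurable.comp hg.1.1, fun p => hφI _ (hg.1.2.1 p), e₁, e₂⟩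

theorem ExtremePt2.ae_eq_zero_or_one {q : (ℝ → ℝ) × (ℝ → ℝ)} (hq : ExtremePt2 Q2 q)
    {g : ℝ × ℝ → ℝ} (hg : IsLeastNorm unitMeasure unitMeasure g q.1 q.2) :
    ∀ᵐ p ∂(unitMeasure.prod unitMeasure), g p = 0 ∨ g p = 1 := by
  obtain ⟨⟨m₁, m₂, -⟩, hext⟩ := hq
  let φ : ℝ → ℝ := fun s => min (2 * s) 1
  let ψ : ℝ → ℝ := fun s => max (2 * s - 1) 0
  have sum : ∀ s, φ s + ψ s = 2 * s := fun s => by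
    rcases le_total (2 * s) 1 with h | h
    · simp only [φ, ψ]; rw [min_eq_left h, max_eq_right (by linarith)]; ring
    · simp only [φ, ψ]; rw [min_eq_right h, max_eq_left (by linarith)]; ring
  obtain ⟨r₁, r₂, hr₁, hr₂, hr⟩ := hg.exists_mem_Q2 m₁ m₂ (φ := φ)
    (fun s t hst => min_le_min (by linarith) le_rfl)
    fun s hs => ⟨le_min (by linarith [hs.1]) zero_le_one, min_le_right _ _⟩
  obtain ⟨s₁, s₂, hs₁, hs₂, hs⟩ := hg.exists_mem_Q2 m₁ m₂ (φ := ψ)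
    (fun s t hst => max_le_max (by linarith) le_rfl)
    fun s hs => ⟨le_max_right _ _, max_le (by linarith [hs.2]) zero_le_one⟩
  have split : ∀ {a b c : ℝ → ℝ} {k : ℝ × ℝ → ℝ}, Measurable k → (∀ p, k p ∈ Set.Icc (0 : ℝ) 1) →
      (a =ᵐ[unitMeasure] fun x => ∫ y, k (x, y) ∂unitMeasure) →
      (b =ᵐ[unitMeasure] fun x => ∫ y, φ (k (x, y)) ∂unitMeasure) →
      (c =ᵐ[unitMeasure] fun x => ∫ y, ψ (k (x, y)) ∂unitMeasure) →
      ∀ᵐ x ∂unitMeasure, 2 * a x = b x + c x := fun {a b c k} km kI ha hb hc => by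
    filter_upwards [ha, hb, hc] with x h1 h2 h3
    have km' : Measurable fun y => k (x, y) := km.comp measurable_prodMk_left
    rw [h1, h2, h3, ← integral_add, ← integral_const_mul]
    · simp only [sum]
    · exact integrable_of_mem_Icc (l := 0) (u := 1)
        ((km'.const_mul 2).min measurable_const).aestronglyMeasurable fun y =>
          ⟨le_min (by linarith [(kI (x, y)).1]) zero_le_one, min_le_right _ _⟩
    · exact integrable_of_mem_Icc (l := 0) (u := 1)
        (((km'.const_mul 2).sub_const 1).max measurable_const).aestronglyMeasurable fun y =>
          ⟨le_max_right _ _, max_le (by linarith [(kI (x, y)).2]) zero_le_one⟩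
  obtain ⟨R₁, S₁, hR₁, hS₁, eR₁, eS₁, hq₁⟩ := m₁.exists_midpoint hr₁ hs₁
    (split hg.1.1 hg.1.2.1 hg.1.2.2.1 hr.2.2.1 hs.2.2.1)
  obtain ⟨R₂, S₂, hR₂, hS₂, eR₂, eS₂, hq₂⟩ := m₂.exists_midpoint hr₂ hs₂
    (split (k := fun p => g p.swap) (hg.1.1.comp measurable_swap) (fun p => hg.1.2.1 p.swap)
      hg.1.2.2.2 hr.2.2.2 hs.2.2.2)
  have hR : HasMarginals unitMeasure unitMeasure (fun p => φ (g p)) R₁ R₂ :=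
    ⟨hr.1, hr.2.1, eR₁.trans hr.2.2.1, eR₂.trans hr.2.2.2⟩
  have hS : HasMarginals unitMeasure unitMeasure (fun p => ψ (g p)) S₁ S₂ :=
    ⟨hs.1, hs.2.1, eS₁.trans hs.2.2.1, eS₂.trans hs.2.2.2⟩
  have heq := hext (R₁, R₂) ⟨hR₁, hR₂, _, hR.rat2⟩ (S₁, S₂) ⟨hS₁, hS₂, _, hS.rat2⟩ (1 / 2)
    (by norm_num) (by norm_num) fun t ht => ⟨hq₁ t ht, hq₂ t ht⟩
  have hle : ∀ p, ψ (g p) ≤ φ (g p) := fun p => by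
    have := hg.1.2.1 p
    exact max_le (le_min (by linarith) (by linarith [this.2]))
      (le_min (by linarith [this.1]) zero_le_one)
  have hint : ∫ p, ψ (g p) ∂(unitMeasure.prod unitMeasure)
      = ∫ p, φ (g p) ∂(unitMeasure.prod unitMeasure) := by
    rw [integral_prod _ hS.integrable, integral_prod _ hR.integrable]
    refine integral_congr_ae ?_
    filter_upwards [hR.2.2.1, hS.2.2.1, ae_restrict_mem measurableSet_Icc] with x h1 h2 hx
    rw [← h1, ← h2]
    exact (heq x hx).1.symm
  have := (integral_eq_iff_of_ae_le hS.integrable hR.integrable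
    (Filter.Eventually.of_forall hle)).1 hint
  filter_upwards [this] with p hp
  have hI := hg.1.2.1 p
  simp only [φ, ψ] at hp
  rcases le_total (2 * g p) 1 with h | h
  · rw [min_eq_left h, max_eq_right (by linarith)] at hp; left; linarith
  · rw [min_eq_right h, max_eq_left (by linarith)] at hp; right; linarith

/-- A function `g` that is positively aligned with `A x + B y` is determined by its marginals. -/
theorem HasMarginals.ae_eq_of_aligned {f g : ℝ × ℝ → ℝ} {a b A B : ℝ → ℝ}
    (hf : HasMarginals unitMeasure unitMeasure f a b)
    (hg : HasMarginals unitMeasure unitMeasure g a b)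
    (hA : Measurable A) (hB : Measurable B) {C : ℝ} (hAC : ∀ᵐ x ∂unitMeasure, |A x| ≤ C)
    (hBC : ∀ᵐ y ∂unitMeasure, |B y| ≤ C)
    (h : ∀ᵐ p ∂(unitMeasure.prod unitMeasure),
      (A p.1 + B p.2 < 0 ∧ g p = 0) ∨ (0 < A p.1 + B p.2 ∧ g p = 1)) :
    f =ᵐ[unitMeasure.prod unitMeasure] g := by
  have hd : Integrable (fun p => g p - f p) (unitMeasure.prod unitMeasure) :=
    hg.integrable.sub hf.integrable
  have iA : Integrable (fun p => A p.1 * (g p - f p)) (unitMeasure.prod unitMeasure) :=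
    hd.bdd_mul (hA.comp measurable_fst).aestronglyMeasurable
      (Measure.quasiMeasurePreserving_fst.ae hAC)
  have iB : Integrable (fun p => B p.2 * (g p - f p)) (unitMeasure.prod unitMeasure) :=
    hd.bdd_mul (hB.comp measurable_snd).aestronglyMeasurable
      (Measure.quasiMeasurePreserving_snd.ae hBC)
  have zA : ∫ p, A p.1 * (g p - f p) ∂(unitMeasure.prod unitMeasure) = 0 := by
    rw [integral_prod _ iA]
    refine integral_eq_zero_of_ae ?_
    filter_upwards [hf.2.2.1, hg.2.2.1, hf.integrable.prod_right_ae, hg.integrable.prod_right_ae]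
      with x h1 h2 h3 h4
    simp only [integral_const_mul]
    rw [integral_sub h4 h3, ← h1, ← h2]; simp
  have zB : ∫ p, B p.2 * (g p - f p) ∂(unitMeasure.prod unitMeasure) = 0 := by
    rw [integral_prod_symm _ iB]
    refine integral_eq_zero_of_ae ?_
    filter_upwards [hf.2.2.2, hg.2.2.2, hf.integrable.prod_left_ae, hg.integrable.prod_left_ae]
      with x h1 h2 h3 h4
    simp only [integral_const_mul]
    rw [integral_sub h4 h3, ← h1, ← h2]; simp
  have iAB : Integrable (fun p => A p.1 * (g p - f p) + B p.2 * (g p - f p))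
      (unitMeasure.prod unitMeasure) := iA.add iB
  have z : ∫ p, (A p.1 * (g p - f p) + B p.2 * (g p - f p))
      ∂(unitMeasure.prod unitMeasure) = 0 := by
    rw [integral_add iA iB, zA, zB, add_zero]
  rw [integral_eq_zero_iff_of_nonneg_ae ?_ iAB] at z
  · filter_upwards [z, h] with p hz hp
    rw [← add_mul, Pi.zero_apply, mul_eq_zero] at hz
    rcases hz with hz | hz
    · rcases hp with hp | hp <;> linarith [hp.1]
    · linarith
  · filter_upwards [h] with p hp
    have hI := hf.2.1 p
    rw [← add_mul]
    rcases hp with ⟨h1, h2⟩ | ⟨h1, h2⟩ <;> rw [h2]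
    · exact mul_nonneg_of_nonpos_of_nonpos h1.le (by linarith [hI.1])
    · exact mul_nonneg h1.le (by linarith [hI.2])

theorem ExtremePt2.ae_eq_of_isLeastNorm {q : (ℝ → ℝ) × (ℝ → ℝ)} (hq : ExtremePt2 Q2 q)
    {f g : ℝ × ℝ → ℝ} (hg : IsLeastNorm unitMeasure unitMeasure g q.1 q.2)
    (hf : HasMarginals unitMeasure unitMeasure f q.1 q.2) :
    f =ᵐ[unitMeasure.prod unitMeasure] g := by
  have gm := hg.1.1
  have gI := hg.1.2.1
  let m : ℝ → ℝ := fun x => ∫ y, g (x, y) ∂unitMeasure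
  have mm : Measurable m :=
    (gm.stronglyMeasurable.integral_prod_right' (ν := unitMeasure)).measurable
  have mono : ∀ᵐ x ∂unitMeasure, ∀ᵐ p ∂(unitMeasure.prod unitMeasure),
      p.1 ≤ p.2 → g (x, p.1) ≤ g (x, p.2) := by
    rw [Measure.ae_ae_comm]
    · filter_upwards [hg.swap.ae_mono hq.1.2.1] with p hp
      by_cases hle : p.1 ≤ p.2
      · filter_upwards [hp hle] with x hx _ using hx
      · exact Filter.Eventually.of_forall fun x h => absurd h hle
    · refine MeasurableSet.imp (measurableSet_le (by fun_prop) (by fun_prop))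
        (measurableSet_le (by fun_prop) (by fun_prop))
  have sep : ∀ᵐ p ∂(unitMeasure.prod unitMeasure),
      (g p = 1 → 1 - p.2 ≤ m p.1) ∧ (g p = 0 → m p.1 ≤ 1 - p.2) := by
    rw [Measure.ae_prod_iff_ae_ae]
    · filter_upwards [mono] with x hx
      exact ae_integral_of_ae_mono (gm.comp measurable_prodMk_left) (fun y => gI _) hx
    · refine MeasurableSet.inter (MeasurableSet.imp ?_ ?_) (MeasurableSet.imp ?_ ?_)
      · exact measurableSet_eq_fun gm measurable_const
      · exact measurableSet_le (by fun_prop) (by fun_prop)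
      · exact measurableSet_eq_fun gm measurable_const
      · exact measurableSet_le (by fun_prop) (by fun_prop)
  have ne : ∀ᵐ p ∂(unitMeasure.prod unitMeasure), p.2 ≠ 1 - m p.1 := by
    rw [Measure.ae_prod_iff_ae_ae]
    · exact Filter.Eventually.of_forall fun x =>
        ae_restrict_of_ae (Measure.ae_ne volume (1 - m x))
    · exact (measurableSet_eq_fun (by fun_prop) (by fun_prop)).compl
  have m01 : ∀ᵐ x ∂unitMeasure, m x ∈ Set.Icc (0 : ℝ) 1 := by
    filter_upwards [hg.1.2.2.1, ae_restrict_mem measurableSet_Icc] with x h1 hx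
    have := hq.1.1.2.1 x hx
    rwa [h1] at this
  refine hf.ae_eq_of_aligned hg.1 (A := m) (B := fun y => y - 1) (C := 1) mm (by fun_prop) ?_ ?_ ?_
  · filter_upwards [m01] with x hx
    rw [abs_le]; constructor <;> linarith [hx.1, hx.2]
  · filter_upwards [ae_restrict_mem measurableSet_Icc] with y hy
    rw [abs_le]; constructor <;> linarith [hy.1, hy.2]
  · filter_upwards [hq.ae_eq_zero_or_one hg, sep, ne] with p h01 hs hne
    rcases h01 with h | h
    · exact Or.inl ⟨lt_of_le_of_ne (by linarith [hs.2 h]) fun e => hne (by linarith), h⟩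
    · exact Or.inr ⟨lt_of_le_of_ne (by linarith [hs.1 h]) fun e => hne (by linarith), h⟩

/-- every extreme point of `𝒬` is uniquely rationalized: any two
(not necessarily monotone) measurable functions rationalizing it agree a.e. on `[0,1]²`. -/
theorem stmt9 (q : (ℝ → ℝ) × (ℝ → ℝ)) (hq : ExtremePt2 Q2 q)
    (f f' : ℝ × ℝ → ℝ) (hf : Rat2 f q.1 q.2) (hf' : Rat2 f' q.1 q.2) :
    f =ᵐ[volume.restrict unitSq] f' := by
  obtain ⟨k, hk, ek⟩ := hf.exists_hasMarginals
  obtain ⟨k', hk', ek'⟩ := hf'.exists_hasMarginals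
  obtain ⟨g, hg⟩ := hk.exists_isLeastNorm
  rw [← prod_unitMeasure]
  exact (ek.trans (hq.ae_eq_of_isLeastNorm hg hk)).trans
    (ek'.trans (hq.ae_eq_of_isLeastNorm hg hk')).symm
end
end

section
/- Let ψ_1, ψ_2 : [0,1] → ℝ be essentially bounded measurable functions, η ∈ ℝ, and let 𝒬̄ = { q ∈ 𝒬 : ∫_0^1 q_1(t)ψ_1(t) dt + ∫_0^1 q_2(t)ψ_2(t) dt ≤ η }. Then every extreme point q of 𝒬̄ is rationalized by a function of the form λ·1_A + (1−λ)·1_{A'}, where λ ∈ [0,1], A' ⊆ A are nested up-sets of [0,1]², and A and A' differ by at most a rectangle, i.e., the set A∖A' coincides up to a Lebesgue-null set with a product [a,b] × [c,d] of closed intervals (possibly empty or degenerate). Moreover, every extreme point q of 𝒬̄ is uniquely rationalized among all monotone functions: any two monotone f, f̃ : [0,1]² → [0,1] that rationalize q are equal almost everywhere. -/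
open MeasureTheory

noncomputable section

open Set Filter Topology

local notation "μI" => Measure.restrict (volume : Measure ℝ) (Set.Icc (0 : ℝ) 1)

local instance isProbabilityMeasure_unitInterval : IsProbabilityMeasure μI :=
  ⟨by simp⟩

lemma unitSq_eq_prod : unitSq = Icc (0 : ℝ) 1 ×ˢ Icc (0 : ℝ) 1 := by
  unfold unitSq
  rw [show (0 : ℝ × ℝ) = (0, 0) from rfl, show (1 : ℝ × ℝ) = (1, 1) from rfl, Icc_prod_eq]

lemma mem_unitSq_iff {z : ℝ × ℝ} : z ∈ unitSq ↔ z.1 ∈ Icc (0 : ℝ) 1 ∧ z.2 ∈ Icc (0 : ℝ) 1 := by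
  rw [unitSq_eq_prod]; rfl

lemma measurableSet_unitSq : MeasurableSet unitSq := measurableSet_Icc

lemma volume_restrict_unitSq :
    (volume.restrict unitSq : Measure (ℝ × ℝ)) = (μI).prod μI := by
  rw [unitSq_eq_prod, Measure.prod_restrict]; rfl

lemma ae_mem_unitSq : ∀ᵐ z ∂((μI).prod μI), z ∈ unitSq := by
  rw [← volume_restrict_unitSq]; exact ae_restrict_mem measurableSet_unitSq

lemma ae_mem_unitInterval : ∀ᵐ t ∂μI, t ∈ Icc (0 : ℝ) 1 := ae_restrict_mem measurableSet_Icc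

/-- Slicewise almost-everywhere statements are almost-everywhere statements for the product measure
as soon as the set they describe is null-measurable. -/
lemma ae_prod_of_ae_ae {α β : Type*} [MeasurableSpace α] [MeasurableSpace β] {μ : Measure α}
    {ν : Measure β} [SFinite ν] {p : α × β → Prop}
    (hp : NullMeasurableSet {z | p z} (μ.prod ν)) (h : ∀ᵐ x ∂μ, ∀ᵐ y ∂ν, p (x, y)) :
    ∀ᵐ z ∂(μ.prod ν), p z := by
  obtain ⟨t, ht, hpt⟩ := hp
  have hpt' : ∀ᵐ z ∂(μ.prod ν), p z ↔ z ∈ t := eventuallyEq_set.1 hpt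
  have h1 : ∀ᵐ z ∂(μ.prod ν), z ∈ t := by
    rw [Measure.ae_prod_iff_ae_ae (p := fun z => z ∈ t) ht]
    filter_upwards [h, Measure.ae_ae_of_ae_prod hpt'] with x hx hx'
    filter_upwards [hx, hx'] with y hy hy' using hy'.1 hy
  filter_upwards [h1, hpt'] with z hz hz' using hz'.2 hz

lemma ae_prod_swap {p : ℝ × ℝ → Prop} (h : ∀ᵐ z ∂((μI).prod μI), p z) :
    ∀ᵐ z ∂((μI).prod μI), p z.swap := by
  rw [← Measure.prod_swap] at h
  exact ae_of_ae_map measurable_swap.aemeasurable h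

lemma integrable_of_mem_Icc_s10 {α : Type*} [MeasurableSpace α] {μ : Measure α} [IsFiniteMeasure μ]
    {f : α → ℝ} (hf : AEMeasurable f μ) (C : ℝ) (h : ∀ᵐ x ∂μ, |f x| ≤ C) : Integrable f μ :=
  Integrable.of_bound hf.aestronglyMeasurable C h

lemma Rat2.aemeasurable {f : ℝ × ℝ → ℝ} {q₁ q₂ : ℝ → ℝ} (h : Rat2 f q₁ q₂) :
    AEMeasurable f ((μI).prod μI) := by
  rw [← volume_restrict_unitSq]; exact h.1

lemma Rat2.ae_mem {f : ℝ × ℝ → ℝ} {q₁ q₂ : ℝ → ℝ} (h : Rat2 f q₁ q₂) :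
    ∀ᵐ z ∂((μI).prod μI), f z ∈ Icc (0 : ℝ) 1 := by
  filter_upwards [ae_mem_unitSq] with z hz using h.2.1 z hz

lemma Rat2.integrable {f : ℝ × ℝ → ℝ} {q₁ q₂ : ℝ → ℝ} (h : Rat2 f q₁ q₂) :
    Integrable f ((μI).prod μI) :=
  integrable_of_mem_Icc_s10 h.aemeasurable 1 (by
    filter_upwards [h.ae_mem] with z hz
    rw [abs_le]; constructor <;> linarith [hz.1, hz.2])

lemma Rat2.congr {f g : ℝ × ℝ → ℝ} {q₁ q₂ : ℝ → ℝ} (h : Rat2 f q₁ q₂)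
    (hg : ∀ z ∈ unitSq, g z ∈ Icc (0 : ℝ) 1) (hfg : f =ᵐ[(μI).prod μI] g) : Rat2 g q₁ q₂ := by
  have hswap := ae_prod_swap hfg
  refine ⟨?_, hg, ?_, ?_⟩
  · rw [volume_restrict_unitSq]; exact h.aemeasurable.congr hfg
  · filter_upwards [h.2.2.1, Measure.ae_ae_of_ae_prod hfg] with t ht ht'
    rw [ht]; exact integral_congr_ae ht'
  · filter_upwards [h.2.2.2, Measure.ae_ae_of_ae_prod hswap] with t ht ht'
    rw [ht]; exact integral_congr_ae ht'

lemma swap_mem_unitSq {z : ℝ × ℝ} (hz : z ∈ unitSq) : z.swap ∈ unitSq := by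
  rw [mem_unitSq_iff] at *; exact ⟨hz.2, hz.1⟩

lemma Rat2.swap {f : ℝ × ℝ → ℝ} {q₁ q₂ : ℝ → ℝ} (h : Rat2 f q₁ q₂) :
    Rat2 (fun z => f z.swap) q₂ q₁ := by
  refine ⟨?_, fun z hz => h.2.1 _ (swap_mem_unitSq hz), h.2.2.2, h.2.2.1⟩
  rw [volume_restrict_unitSq]
  refine AEMeasurable.comp_measurable (f := Prod.swap) ?_ measurable_swap
  rw [Measure.prod_swap]; exact h.aemeasurable

/-- The left-continuous version of `r` on `(0, 1]`, with the prescribed value `c` at `0`. -/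
def leftVersion (r : ℝ → ℝ) (c : ℝ) (t : ℝ) : ℝ := if t = 0 then c else Function.leftLim r t

lemma leftVersion_ae_eq {r : ℝ → ℝ} (hr : Monotone r) (c : ℝ) : leftVersion r c =ᵐ[μI] r := by
  have h1 : ∀ᵐ t ∂(volume : Measure ℝ), t ≠ 0 := by simp [ae_iff]
  have h2 := hr.countable_not_continuousAt.ae_notMem (volume : Measure ℝ)
  filter_upwards [ae_restrict_of_ae h1, ae_restrict_of_ae h2] with t ht ht'
  have hc : ContinuousAt r t := by simpa using ht'
  rw [leftVersion, if_neg ht]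
  exact hc.continuousWithinAt.leftLim_eq

lemma leftVersion_tendsto {r : ℝ → ℝ} (hr : Monotone r) (c : ℝ) {t : ℝ} (ht : 0 < t) :
    Tendsto (leftVersion r c) (𝓝[<] t) (𝓝 (leftVersion r c t)) := by
  have h : Tendsto (Function.leftLim r) (𝓝[<] t) (𝓝 (Function.leftLim r t)) := by
    have := hr.leftLim.tendsto_leftLim t
    rwa [leftLim_leftLim (hr.tendsto_leftLim t)] at this
  rw [show leftVersion r c t = Function.leftLim r t from if_neg ht.ne']
  refine h.congr' ?_
  filter_upwards [Ioo_mem_nhdsLT ht] with s hs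
  rw [leftVersion, if_neg hs.1.ne']

lemma leftVersion_monoLC {r : ℝ → ℝ} (hr : Monotone r) (hr' : ∀ t, r t ∈ Icc (0 : ℝ) 1) {c : ℝ}
    (hc : c ∈ Icc 0 (Function.rightLim r 0)) : MonoLC (leftVersion r c) := by
  have hle : ∀ t, 0 < t → c ≤ Function.leftLim r t := fun t ht =>
    hc.2.trans (hr.rightLim_le_leftLim ht)
  refine ⟨fun s hs t ht hst => ?_, fun t ht => ?_, fun t ht => leftVersion_tendsto hr c ht.1⟩
  · unfold leftVersion
    split_ifs with h1 h2 h2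
    · exact le_rfl
    · exact hle t (lt_of_le_of_ne ht.1 (Ne.symm h2))
    · exact absurd (le_antisymm (h2 ▸ hst) hs.1) h1
    · exact hr.leftLim hst
  · unfold leftVersion
    split_ifs with h1
    · exact ⟨hc.1, hc.2.trans ((hr.rightLim_le one_pos).trans (hr' 1).2)⟩
    · exact ⟨(hr' (t - 1)).1.trans (hr.le_leftLim (by linarith)),
        (hr.leftLim_le le_rfl).trans (hr' t).2⟩

lemma eq_of_ae_eq_of_leftContinuous {p s : ℝ → ℝ} (h : p =ᵐ[μI] s) {t : ℝ}
    (ht : t ∈ Ioc (0 : ℝ) 1) (hp : Tendsto p (𝓝[<] t) (𝓝 (p t)))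
    (hs : Tendsto s (𝓝[<] t) (𝓝 (s t))) : p t = s t := by
  refine tendsto_nhds_unique_of_frequently_eq hp hs ?_
  intro hne
  obtain ⟨u, hu, hu'⟩ := (mem_nhdsLT_iff_exists_Ioo_subset' ht.1).1 hne
  have h0 : μI (Ioo (max u 0) t) = 0 := by
    refine measure_mono_null (fun x hx => ?_) h
    exact hu' ⟨(le_max_left _ _).trans_lt hx.1, hx.2⟩
  rw [Measure.restrict_apply measurableSet_Ioo, inter_eq_left.2, Real.volume_Ioo,
    ENNReal.ofReal_eq_zero] at h0
  · have : max u 0 < t := max_lt hu ht.1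
    linarith
  · exact fun x hx => ⟨((le_max_right _ _).trans_lt hx.1).le, hx.2.le.trans ht.2⟩

lemma le_rightLim_zero_of_ae_eq {p r : ℝ → ℝ} (hp : MonoLC p) (hr : Monotone r)
    (h : p =ᵐ[μI] r) : p 0 ≤ Function.rightLim r 0 := by
  refine ge_of_tendsto (hr.tendsto_rightLim 0) ?_
  filter_upwards [Ioo_mem_nhdsGT (zero_lt_one (α := ℝ))] with t ht
  by_contra! hlt
  have h0 : μI (Ioo 0 t) = 0 := by
    refine measure_mono_null (fun x hx => ?_) h
    intro hx'
    have h1 : p 0 ≤ p x := hp.1 (by simp) ⟨hx.1.le, hx.2.le.trans ht.2.le⟩ hx.1.le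
    have h2 : r x ≤ r t := hr hx.2.le
    have h3 : p x = r x := hx'
    linarith
  rw [Measure.restrict_apply measurableSet_Ioo, inter_eq_left.2, Real.volume_Ioo,
    ENNReal.ofReal_eq_zero] at h0
  · linarith [ht.1]
  · exact fun x hx => ⟨hx.1.le, hx.2.le.trans ht.2.le⟩

/-- If the left-continuous `p` is a.e. the midpoint of two nondecreasing functions, it is everywhere
on `[0, 1]` the midpoint of suitable left-continuous versions of them. -/
lemma exists_monoLC_midpoint {p r s : ℝ → ℝ} (hp : MonoLC p) (hr : Monotone r) (hs : Monotone s)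
    (hr' : ∀ t, r t ∈ Icc (0 : ℝ) 1) (hs' : ∀ t, s t ∈ Icc (0 : ℝ) 1)
    (h : ∀ᵐ t ∂μI, p t = (r t + s t) / 2) :
    ∃ r' s' : ℝ → ℝ, MonoLC r' ∧ MonoLC s' ∧ r' =ᵐ[μI] r ∧ s' =ᵐ[μI] s ∧
      ∀ t ∈ Icc (0 : ℝ) 1, p t = 1 / 2 * r' t + (1 - 1 / 2) * s' t := by
  set L := Function.rightLim r 0 with hL
  set M := Function.rightLim s 0 with hM
  have hL0 : 0 ≤ L := (hr' 0).1.trans (hr.le_rightLim le_rfl)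
  have hM0 : 0 ≤ M := (hs' 0).1.trans (hs.le_rightLim le_rfl)
  have hp0 : 0 ≤ p 0 := (hp.2.1 0 (by simp)).1
  have hLM : 2 * p 0 ≤ L + M := by
    have hm : Monotone (fun t => (r t + s t) / 2) := fun a b hab => by
      have := hr hab; have := hs hab; dsimp only; linarith
    have h1 := le_rightLim_zero_of_ae_eq hp hm h
    have h2 : Function.rightLim (fun t => (r t + s t) / 2) 0 = (L + M) / 2 :=
      tendsto_nhds_unique (hm.tendsto_rightLim 0)
        (((hr.tendsto_rightLim 0).add (hs.tendsto_rightLim 0)).div_const 2)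
    linarith
  have ha : min L (2 * p 0) ∈ Icc 0 L := ⟨le_min hL0 (by linarith), min_le_left _ _⟩
  have hb : 2 * p 0 - min L (2 * p 0) ∈ Icc 0 M :=
    ⟨by linarith [min_le_right L (2 * p 0)], by
      rcases min_choice L (2 * p 0) with h | h <;> rw [h] <;> linarith⟩
  refine ⟨leftVersion r (min L (2 * p 0)), leftVersion s (2 * p 0 - min L (2 * p 0)),
    leftVersion_monoLC hr hr' ha, leftVersion_monoLC hs hs' hb, leftVersion_ae_eq hr _,
    leftVersion_ae_eq hs _, fun t ht => ?_⟩
  rcases eq_or_lt_of_le ht.1 with h0 | h0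
  · rw [← h0]; simp only [leftVersion, if_true]; ring
  · refine eq_of_ae_eq_of_leftContinuous (s := fun t => 1 / 2 * leftVersion r (min L (2 * p 0)) t +
      (1 - 1 / 2) * leftVersion s (2 * p 0 - min L (2 * p 0)) t) ?_ ⟨h0, ht.2⟩ (hp.2.2 t ⟨h0, ht.2⟩)
      (((leftVersion_tendsto hr _ h0).const_mul _).add ((leftVersion_tendsto hs _ h0).const_mul _))
    filter_upwards [h, leftVersion_ae_eq hr (min L (2 * p 0)),
      leftVersion_ae_eq hs (2 * p 0 - min L (2 * p 0))] with x hx h1 h2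
    rw [hx, h1, h2]; ring

/-- First marginal of a function on the unit square. -/
def marg₁ (f : ℝ × ℝ → ℝ) (x : ℝ) : ℝ := ∫ y, f (x, y) ∂μI

/-- Second marginal of a function on the unit square. -/
def marg₂ (f : ℝ × ℝ → ℝ) (y : ℝ) : ℝ := ∫ x, f (x, y) ∂μI

/-- Rationalizable pairs satisfying the linear constraint given by `ψ₁`, `ψ₂` and `η`. -/
def constrainedQ2 (ψ₁ ψ₂ : ℝ → ℝ) (η : ℝ) : Set ((ℝ → ℝ) × (ℝ → ℝ)) :=
  {p | p ∈ Q2 ∧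
    (∫ t in Set.Icc (0 : ℝ) 1, p.1 t * ψ₁ t) + (∫ t in Set.Icc (0 : ℝ) 1, p.2 t * ψ₂ t) ≤ η}

/-- `ψ` is measurable and essentially bounded on `[0, 1]`. -/
def EssBdd (ψ : ℝ → ℝ) : Prop := Measurable ψ ∧ ∃ C : ℝ, ∀ᵐ t ∂μI, |ψ t| ≤ C

lemma EssBdd.integrable_mul {ψ g : ℝ → ℝ} (hψ : EssBdd ψ) (hg : AEMeasurable g μI)
    (hg' : ∀ᵐ t ∂μI, |g t| ≤ 1) : Integrable (fun t => g t * ψ t) μI := by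
  obtain ⟨hm, C, hC⟩ := hψ
  refine integrable_of_mem_Icc_s10 (hg.mul hm.aemeasurable) C ?_
  filter_upwards [hC, hg'] with t h1 h2
  rw [abs_mul]
  nlinarith [abs_nonneg (g t), abs_nonneg (ψ t)]

lemma aemeasurable_marg₁ {f : ℝ × ℝ → ℝ} (hf : AEMeasurable f ((μI).prod μI)) :
    AEMeasurable (marg₁ f) μI :=
  (hf.aestronglyMeasurable.integral_prod_right').aemeasurable

lemma aemeasurable_swap {f : ℝ × ℝ → ℝ} (hf : AEMeasurable f ((μI).prod μI)) :
    AEMeasurable (fun z : ℝ × ℝ => f z.swap) ((μI).prod μI) := by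
  refine AEMeasurable.comp_measurable (f := Prod.swap) ?_ measurable_swap
  rw [Measure.prod_swap]; exact hf

lemma aemeasurable_marg₂ {f : ℝ × ℝ → ℝ} (hf : AEMeasurable f ((μI).prod μI)) :
    AEMeasurable (marg₂ f) μI :=
  aemeasurable_marg₁ (aemeasurable_swap hf)

lemma abs_integral_le_of_abs_le {f : ℝ → ℝ} {C : ℝ} (h : ∀ y, |f y| ≤ C) :
    |∫ y, f y ∂μI| ≤ C := by
  have := norm_integral_le_of_norm_le_const (μ := μI) (f := f) (C := C) (Eventually.of_forall h)
  simpa using this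

lemma integral_mem_Icc {f : ℝ → ℝ} (h : ∀ y, f y ∈ Icc (0 : ℝ) 1) :
    ∫ y, f y ∂μI ∈ Icc (0 : ℝ) 1 := by
  refine ⟨integral_nonneg fun y => (h y).1, ?_⟩
  refine (le_abs_self _).trans (abs_integral_le_of_abs_le fun y => ?_)
  rw [abs_of_nonneg (h y).1]; exact (h y).2

/-- A nondecreasing function on the plane with values in `[0, 1]`. -/
structure MonoUnit (F : ℝ × ℝ → ℝ) : Prop where
  mono : Monotone F
  mem : ∀ z, F z ∈ Icc (0 : ℝ) 1

lemma MonoUnit.swap {F : ℝ × ℝ → ℝ} (h : MonoUnit F) : MonoUnit (fun z => F z.swap) :=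
  ⟨fun _ _ hab => h.mono (Prod.swap_le_swap.2 hab), fun _ => h.mem _⟩

lemma MonoUnit.measurable_fst {F : ℝ × ℝ → ℝ} (h : MonoUnit F) (x : ℝ) :
    Measurable (fun y => F (x, y)) :=
  Monotone.measurable fun _ _ hab => h.mono (Prod.mk_le_mk.2 ⟨le_rfl, hab⟩)

lemma MonoUnit.integrable_fst {F : ℝ × ℝ → ℝ} (h : MonoUnit F) (x : ℝ) :
    Integrable (fun y => F (x, y)) μI :=
  integrable_of_mem_Icc_s10 (h.measurable_fst x).aemeasurable 1 (Eventually.of_forall fun y => by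
    rw [abs_of_nonneg (h.mem _).1]; exact (h.mem _).2)

lemma MonoUnit.marg₁_mono {F : ℝ × ℝ → ℝ} (h : MonoUnit F) : Monotone (marg₁ F) := fun a b hab =>
  integral_mono (h.integrable_fst a) (h.integrable_fst b) fun _ =>
    h.mono (Prod.mk_le_mk.2 ⟨hab, le_rfl⟩)

/-- Slicewise part of the admissibility of a perturbation `k` of `F`: on each slice `k` is
measurable, and the marginal of `k` varies at most as much as that of `F`. -/
structure DominatedMarginal (F k : ℝ × ℝ → ℝ) : Prop where
  measurable_slice : ∀ x, Measurable fun y => k (x, y)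
  abs_sub_le : ∀ x x', x ≤ x' → |marg₁ k x' - marg₁ k x| ≤ marg₁ F x' - marg₁ F x

lemma DominatedMarginal.midpoint {F k : ℝ × ℝ → ℝ} {p : ℝ → ℝ} (hF : MonoUnit F)
    (h : DominatedMarginal F k) (hk : ∀ z, |k z| ≤ F z ∧ |k z| ≤ 1 - F z) (hp : MonoLC p)
    (hpF : ∀ᵐ t ∂μI, p t = marg₁ F t) :
    ∃ r s : ℝ → ℝ, MonoLC r ∧ MonoLC s ∧ (∀ᵐ t ∂μI, r t = marg₁ (fun z => F z + k z) t) ∧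
      (∀ᵐ t ∂μI, s t = marg₁ (fun z => F z - k z) t) ∧
      (∀ᵐ t ∂μI, r t = p t + marg₁ k t) ∧ (∀ᵐ t ∂μI, s t = p t - marg₁ k t) ∧
      ∀ t ∈ Icc (0 : ℝ) 1, p t = 1 / 2 * r t + (1 - 1 / 2) * s t := by
  have hki : ∀ x, Integrable (fun y => k (x, y)) μI := fun x =>
    integrable_of_mem_Icc_s10 (h.measurable_slice x).aemeasurable 1 (Eventually.of_forall fun y =>
      (hk _).1.trans (hF.mem _).2)
  have hadd : ∀ t, marg₁ (fun z => F z + k z) t = marg₁ F t + marg₁ k t := fun t =>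
    integral_add (hF.integrable_fst t) (hki t)
  have hsub : ∀ t, marg₁ (fun z => F z - k z) t = marg₁ F t - marg₁ k t := fun t =>
    integral_sub (hF.integrable_fst t) (hki t)
  obtain ⟨r, s, hr, hs, hrr, hss, hmid⟩ := exists_monoLC_midpoint (p := p)
    (r := marg₁ (fun z => F z + k z)) (s := marg₁ (fun z => F z - k z)) hp
    (fun a b hab => by
      have := abs_le.1 (h.abs_sub_le a b hab); rw [hadd, hadd]; linarith [this.1])
    (fun a b hab => by
      have := abs_le.1 (h.abs_sub_le a b hab); rw [hsub, hsub]; linarith [this.2])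
    (fun t => integral_mem_Icc fun y => by
      have h1 := hk (t, y); have h2 := abs_le.1 h1.1; have h3 := abs_le.1 h1.2
      constructor <;> linarith)
    (fun t => integral_mem_Icc fun y => by
      have h1 := hk (t, y); have h2 := abs_le.1 h1.1; have h3 := abs_le.1 h1.2
      constructor <;> linarith)
    (by filter_upwards [hpF] with t ht; rw [hadd, hsub, ht]; ring)
  refine ⟨r, s, hr, hs, hrr, hss, ?_, ?_, hmid⟩
  · filter_upwards [hrr, hpF] with t h1 h2; rw [h1, h2, hadd]
  · filter_upwards [hss, hpF] with t h1 h2; rw [h1, h2, hsub]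

lemma MonoLC.integrable_mul {p ψ : ℝ → ℝ} (hp : MonoLC p) (hψ : EssBdd ψ) :
    Integrable (fun t => p t * ψ t) μI := by
  refine hψ.integrable_mul (aemeasurable_restrict_of_monotoneOn measurableSet_Icc hp.1) ?_
  filter_upwards [ae_mem_unitInterval] with t ht
  rw [abs_of_nonneg (hp.2.1 t ht).1]; exact (hp.2.1 t ht).2

/-- A perturbation of a monotone rationalization that preserves the constraint has vanishing
marginals when the rationalized pair is extreme. -/
lemma ExtremePt2.marg_eq_zero {ψ₁ ψ₂ : ℝ → ℝ} {η : ℝ} {q : (ℝ → ℝ) × (ℝ → ℝ)}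
    (hψ₁ : EssBdd ψ₁) (hψ₂ : EssBdd ψ₂) (hq : ExtremePt2 (constrainedQ2 ψ₁ ψ₂ η) q)
    {F k : ℝ × ℝ → ℝ} (hF : MonoUnit F) (hR : Rat2 F q.1 q.2)
    (hkm : AEMeasurable k ((μI).prod μI)) (hk : ∀ z, |k z| ≤ F z ∧ |k z| ≤ 1 - F z)
    (h₁ : DominatedMarginal F k) (h₂ : DominatedMarginal (fun z => F z.swap) (fun z => k z.swap))
    (hℓ : (∫ t, marg₁ k t * ψ₁ t ∂μI) + (∫ t, marg₂ k t * ψ₂ t ∂μI) = 0) :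
    (∀ᵐ t ∂μI, marg₁ k t = 0) ∧ (∀ᵐ t ∂μI, marg₂ k t = 0) := by
  obtain ⟨⟨⟨hq1, hq2, -⟩, hη⟩, hext⟩ := hq
  obtain ⟨r₁, s₁, hr₁, hs₁, hr₁F, hs₁F, hr₁k, hs₁k, hm₁⟩ := h₁.midpoint hF hk hq1 hR.2.2.1
  obtain ⟨r₂, s₂, hr₂, hs₂, hr₂F, hs₂F, hr₂k, hs₂k, hm₂⟩ :=
    h₂.midpoint hF.swap (fun z => hk z.swap) hq2 hR.2.2.2
  have hk1 : ∀ t, |marg₁ k t| ≤ 1 := fun t =>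
    abs_integral_le_of_abs_le fun y => (hk _).1.trans (hF.mem _).2
  have hk2 : ∀ t, |marg₂ k t| ≤ 1 := fun t =>
    abs_integral_le_of_abs_le fun y => (hk _).1.trans (hF.mem _).2
  have hi1 := hψ₁.integrable_mul (aemeasurable_marg₁ hkm) (Eventually.of_forall hk1)
  have hi2 := hψ₂.integrable_mul (aemeasurable_marg₂ hkm) (Eventually.of_forall hk2)
  have hint : ∀ (p r K ψ : ℝ → ℝ) (ε : ℝ), Integrable (fun t => p t * ψ t) μI →
      Integrable (fun t => K t * ψ t) μI → (∀ᵐ t ∂μI, r t = p t + ε * K t) →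
      ∫ t, r t * ψ t ∂μI = (∫ t, p t * ψ t ∂μI) + ε * ∫ t, K t * ψ t ∂μI := by
    intro p r K ψ ε hp hK hr
    rw [← integral_const_mul, ← integral_add hp (hK.const_mul ε)]
    refine integral_congr_ae ?_
    filter_upwards [hr] with t ht
    rw [ht]; ring
  have hadd : (r₁, r₂) ∈ constrainedQ2 ψ₁ ψ₂ η := by
    refine ⟨⟨hr₁, hr₂, fun z => F z + k z, ?_, fun z _ => ?_, hr₁F, hr₂F⟩, ?_⟩
    · rw [volume_restrict_unitSq]; exact hR.aemeasurable.add hkm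
    · have h1 := hk z; have h2 := abs_le.1 h1.1; have h3 := abs_le.1 h1.2
      constructor <;> linarith
    · change (∫ t, r₁ t * ψ₁ t ∂μI) + (∫ t, r₂ t * ψ₂ t ∂μI) ≤ η
      rw [hint q.1 r₁ (marg₁ k) ψ₁ 1 (hq1.integrable_mul hψ₁) hi1 (by simpa using hr₁k),
        hint q.2 r₂ (marg₂ k) ψ₂ 1 (hq2.integrable_mul hψ₂) hi2
          (by simp only [one_mul]; exact hr₂k)]
      linarith
  have hsub : (s₁, s₂) ∈ constrainedQ2 ψ₁ ψ₂ η := by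
    refine ⟨⟨hs₁, hs₂, fun z => F z - k z, ?_, fun z _ => ?_, hs₁F, hs₂F⟩, ?_⟩
    · rw [volume_restrict_unitSq]; exact hR.aemeasurable.sub hkm
    · have h1 := hk z; have h2 := abs_le.1 h1.1; have h3 := abs_le.1 h1.2
      constructor <;> linarith
    · change (∫ t, s₁ t * ψ₁ t ∂μI) + (∫ t, s₂ t * ψ₂ t ∂μI) ≤ η
      rw [hint q.1 s₁ (marg₁ k) ψ₁ (-1) (hq1.integrable_mul hψ₁) hi1
          (by filter_upwards [hs₁k] with t ht; rw [ht]; ring),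
        hint q.2 s₂ (marg₂ k) ψ₂ (-1) (hq2.integrable_mul hψ₂) hi2
          (by filter_upwards [hs₂k] with t ht; rw [ht, marg₂, marg₁]; simp only [Prod.swap]; ring)]
      linarith
  have heq := hext _ hadd _ hsub (1 / 2) (by norm_num) (by norm_num)
    fun t ht => ⟨hm₁ t ht, hm₂ t ht⟩
  constructor
  · filter_upwards [ae_mem_unitInterval, hr₁k, hs₁k] with t ht h1 h2
    have := (heq t ht).1
    simp only at this
    linarith
  · filter_upwards [ae_mem_unitInterval, hr₂k, hs₂k] with t ht h1 h2
    have := (heq t ht).2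
    change marg₁ (fun z => k z.swap) t = 0
    simp only at this
    linarith

/-- The tent function, vanishing at `0` and `1`. -/
def tent (v : ℝ) : ℝ := min v (1 - v)

lemma abs_tent_sub_le (a b : ℝ) : |tent a - tent b| ≤ |a - b| := by
  refine (abs_min_sub_min_le_max _ _ _ _).trans (max_le le_rfl ?_)
  rw [show 1 - a - (1 - b) = -(a - b) by ring, abs_neg]

lemma measurable_tent : Measurable tent := measurable_id.min (measurable_const.sub measurable_id)

lemma tent_nonneg {v : ℝ} (h : v ∈ Icc (0 : ℝ) 1) : 0 ≤ tent v :=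
  le_min h.1 (by linarith [h.2])

lemma tent_le (v : ℝ) : tent v ≤ v ∧ tent v ≤ 1 - v := ⟨min_le_left _ _, min_le_right _ _⟩

lemma tent_eq_zero {v : ℝ} (h : tent v = 0) : v = 0 ∨ v = 1 := by
  unfold tent at h
  rcases min_choice v (1 - v) with h' | h' <;> rw [h'] at h
  · exact Or.inl h
  · right; linarith

lemma abs_tent_le_one {v : ℝ} (h : v ∈ Icc (0 : ℝ) 1) : |tent v| ≤ 1 := by
  rw [abs_of_nonneg (tent_nonneg h)]; exact (tent_le v).1.trans h.2

/-- The perturbation of `F` with weight depending affinely on the first marginal of `F`. -/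
def tentPert (F : ℝ × ℝ → ℝ) (s t : ℝ) (z : ℝ × ℝ) : ℝ := (s + t * marg₁ F z.1) * tent (F z)

lemma marg₁_tentPert (F : ℝ × ℝ → ℝ) (s t x : ℝ) :
    marg₁ (tentPert F s t) x = (s + t * marg₁ F x) * marg₁ (fun z => tent (F z)) x :=
  integral_const_mul (s + t * marg₁ F x) (fun y => tent (F (x, y)))

lemma MonoUnit.marg₁_mem {F : ℝ × ℝ → ℝ} (hF : MonoUnit F) (x : ℝ) : marg₁ F x ∈ Icc (0 : ℝ) 1 :=
  integral_mem_Icc fun _ => hF.mem _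

lemma MonoUnit.abs_weight_le {F : ℝ × ℝ → ℝ} (hF : MonoUnit F) (s t x : ℝ) :
    |s + t * marg₁ F x| ≤ |s| + |t| := by
  have h := hF.marg₁_mem x
  refine (abs_add_le _ _).trans ?_
  rw [abs_mul, abs_of_nonneg h.1]
  nlinarith [abs_nonneg t, h.2]

lemma MonoUnit.integrable_tent_fst {F : ℝ × ℝ → ℝ} (hF : MonoUnit F) (x : ℝ) :
    Integrable (fun y => tent (F (x, y))) μI :=
  integrable_of_mem_Icc_s10 (measurable_tent.comp (hF.measurable_fst x)).aemeasurable 1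
    (Eventually.of_forall fun _ => abs_tent_le_one (hF.mem _))

lemma abs_tentPert_le {F : ℝ × ℝ → ℝ} (hF : MonoUnit F) {s t : ℝ} (hst : |s| + |t| ≤ 1)
    (z : ℝ × ℝ) :
    |tentPert F s t z| ≤ tent (F z) := by
  rw [tentPert, abs_mul, abs_of_nonneg (tent_nonneg (hF.mem z))]
  have := hF.abs_weight_le s t z.1
  nlinarith [tent_nonneg (hF.mem z)]

lemma MonoUnit.abs_marg₁_tent_sub_le {F : ℝ × ℝ → ℝ} (hF : MonoUnit F) {x x' : ℝ} (hx : x ≤ x') :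
    |marg₁ (fun z => tent (F z)) x' - marg₁ (fun z => tent (F z)) x| ≤
      marg₁ F x' - marg₁ F x := by
  rw [marg₁, marg₁, marg₁, marg₁, ← integral_sub (hF.integrable_tent_fst x')
    (hF.integrable_tent_fst x), ← integral_sub (hF.integrable_fst x') (hF.integrable_fst x)]
  refine (abs_integral_le_integral_abs).trans (integral_mono
    ((hF.integrable_tent_fst x').sub (hF.integrable_tent_fst x)).abs
    ((hF.integrable_fst x').sub (hF.integrable_fst x)) fun y => ?_)
  refine (abs_tent_sub_le _ _).trans_eq (abs_of_nonneg ?_)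
  have : F (x, y) ≤ F (x', y) := hF.mono (Prod.mk_le_mk.2 ⟨hx, le_rfl⟩)
  linarith

lemma tentPert_dominated_fst {F : ℝ × ℝ → ℝ} (hF : MonoUnit F) {s t : ℝ} (hst : |s| + |t| ≤ 1 / 2) :
    DominatedMarginal F (tentPert F s t) := by
  refine ⟨fun x => (measurable_tent.comp (hF.measurable_fst x)).const_mul (s + t * marg₁ F x),
    fun x x' hx => ?_⟩
  rw [marg₁_tentPert, marg₁_tentPert]
  have h1 := hF.abs_marg₁_tent_sub_le hx
  have h2 := hF.abs_weight_le s t x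
  have h3 : |marg₁ (fun z => tent (F z)) x'| ≤ 1 :=
    abs_integral_le_of_abs_le fun y => abs_tent_le_one (hF.mem _)
  have h4 := hF.marg₁_mono hx
  set a := marg₁ F x
  set a' := marg₁ F x'
  set b := marg₁ (fun z => tent (F z)) x
  set b' := marg₁ (fun z => tent (F z)) x'
  have h5 : (s + t * a') * b' - (s + t * a) * b = t * (a' - a) * b' + (s + t * a) * (b' - b) := by
    ring
  rw [h5]
  have h6 : |t * (a' - a) * b'| ≤ |t| * (a' - a) := by
    rw [abs_mul, abs_mul, abs_of_nonneg (sub_nonneg.2 h4)]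
    exact mul_le_of_le_one_right (mul_nonneg (abs_nonneg _) (sub_nonneg.2 h4)) h3
  have h7 : |(s + t * a) * (b' - b)| ≤ (|s| + |t|) * (a' - a) := by
    rw [abs_mul]
    exact mul_le_mul h2 h1 (abs_nonneg _) (by positivity)
  refine (abs_add_le _ _).trans ((add_le_add h6 h7).trans ?_)
  nlinarith [abs_nonneg s, abs_nonneg t, sub_nonneg.2 h4]

lemma MonoUnit.measurable_tentPert_snd {F : ℝ × ℝ → ℝ} (hF : MonoUnit F) (s t y : ℝ) :
    Measurable fun x => tentPert F s t (x, y) :=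
  (measurable_const.add (hF.marg₁_mono.measurable.const_mul t)).mul
    (measurable_tent.comp (hF.swap.measurable_fst y))

lemma tentPert_dominated_snd {F : ℝ × ℝ → ℝ} (hF : MonoUnit F) {s t : ℝ} (hst : |s| + |t| ≤ 1 / 2) :
    DominatedMarginal (fun z => F z.swap) (fun z => tentPert F s t z.swap) := by
  refine ⟨fun y => hF.measurable_tentPert_snd s t y, fun y y' hy => ?_⟩
  have hi : ∀ y, Integrable (fun x => tentPert F s t (x, y)) μI := fun y =>
    integrable_of_mem_Icc_s10 (hF.measurable_tentPert_snd s t y).aemeasurable 1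
      (Eventually.of_forall fun x => (abs_tentPert_le hF (by linarith) _).trans
        ((tent_le _).1.trans (hF.mem _).2))
  change |(∫ x, tentPert F s t (x, y') ∂μI) - ∫ x, tentPert F s t (x, y) ∂μI| ≤
    (∫ x, F (x, y') ∂μI) - ∫ x, F (x, y) ∂μI
  have hiF : ∀ y, Integrable (fun x => F (x, y)) μI := hF.swap.integrable_fst
  rw [← integral_sub (hi y') (hi y), ← integral_sub (hiF y') (hiF y)]
  refine (abs_integral_le_integral_abs).trans (integral_mono ((hi y').sub (hi y)).abs
    ((hiF y').sub (hiF y)) fun x => ?_)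
  have h0 : F (x, y) ≤ F (x, y') := hF.mono (Prod.mk_le_mk.2 ⟨le_rfl, hy⟩)
  have h1 := abs_tent_sub_le (F (x, y')) (F (x, y))
  rw [abs_of_nonneg (sub_nonneg.2 h0)] at h1
  have h2 := hF.abs_weight_le s t x
  simp only [tentPert]
  rw [← mul_sub, abs_mul]
  nlinarith [abs_nonneg (s + t * marg₁ F x), abs_nonneg (tent (F (x, y')) - tent (F (x, y)))]

lemma aemeasurable_tentPert {F : ℝ × ℝ → ℝ} (hF : MonoUnit F)
    (hm : AEMeasurable F ((μI).prod μI)) (s t : ℝ) :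
    AEMeasurable (tentPert F s t) ((μI).prod μI) :=
  ((measurable_const.add ((hF.marg₁_mono.measurable.comp measurable_fst).const_mul
    t)).aemeasurable).mul (measurable_tent.comp_aemeasurable hm)

/-- The value of the constraint functional on the marginals of `k`. -/
def constraintVal (ψ₁ ψ₂ : ℝ → ℝ) (k : ℝ × ℝ → ℝ) : ℝ :=
  (∫ t, marg₁ k t * ψ₁ t ∂μI) + (∫ t, marg₂ k t * ψ₂ t ∂μI)

lemma constraintVal_tentPert {ψ₁ ψ₂ : ℝ → ℝ} (hψ₁ : EssBdd ψ₁) (hψ₂ : EssBdd ψ₂)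
    {F : ℝ × ℝ → ℝ} (hF : MonoUnit F) (hm : AEMeasurable F ((μI).prod μI)) (s t : ℝ) :
    constraintVal ψ₁ ψ₂ (tentPert F s t) = s * constraintVal ψ₁ ψ₂ (tentPert F 1 0) +
      t * constraintVal ψ₁ ψ₂ (tentPert F 0 1) := by
  have hb : ∀ s t, |s| + |t| ≤ 1 → ∀ z, |tentPert F s t z| ≤ 1 := fun s t hst z =>
    (abs_tentPert_le hF hst z).trans ((tent_le _).1.trans (hF.mem _).2)
  have hb10 := hb 1 0 (by simp)
  have hb01 := hb 0 1 (by simp)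
  have e1 : ∀ x, marg₁ (tentPert F s t) x =
      s * marg₁ (tentPert F 1 0) x + t * marg₁ (tentPert F 0 1) x := fun x => by
    rw [marg₁_tentPert, marg₁_tentPert, marg₁_tentPert]; ring
  have e2 : ∀ y, marg₂ (tentPert F s t) y =
      s * marg₂ (tentPert F 1 0) y + t * marg₂ (tentPert F 0 1) y := fun y => by
    have hi : ∀ s t, |s| + |t| ≤ 1 → Integrable (fun x => tentPert F s t (x, y)) μI :=
      fun s t hst => integrable_of_mem_Icc_s10 (hF.measurable_tentPert_snd s t y).aemeasurable 1
        (Eventually.of_forall fun x => hb s t hst _)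
    rw [marg₂, marg₂, marg₂, ← integral_const_mul, ← integral_const_mul,
      ← integral_add ((hi 1 0 (by simp)).const_mul s) ((hi 0 1 (by simp)).const_mul t)]
    refine integral_congr_ae (Eventually.of_forall fun x => ?_)
    simp only [tentPert]; ring
  have i1 : ∀ s t, |s| + |t| ≤ 1 → Integrable (fun x => marg₁ (tentPert F s t) x * ψ₁ x) μI :=
    fun s t hst => hψ₁.integrable_mul (aemeasurable_marg₁ (aemeasurable_tentPert hF hm s t))
      (Eventually.of_forall fun x => abs_integral_le_of_abs_le fun y => hb s t hst _)
  have i2 : ∀ s t, |s| + |t| ≤ 1 → Integrable (fun x => marg₂ (tentPert F s t) x * ψ₂ x) μI :=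
    fun s t hst => hψ₂.integrable_mul (aemeasurable_marg₂ (aemeasurable_tentPert hF hm s t))
      (Eventually.of_forall fun x => abs_integral_le_of_abs_le fun y => hb s t hst _)
  have f1 : ∫ x, marg₁ (tentPert F s t) x * ψ₁ x ∂μI =
      s * (∫ x, marg₁ (tentPert F 1 0) x * ψ₁ x ∂μI) +
        t * ∫ x, marg₁ (tentPert F 0 1) x * ψ₁ x ∂μI := by
    rw [← integral_const_mul, ← integral_const_mul,
      ← integral_add ((i1 1 0 (by simp)).const_mul s) ((i1 0 1 (by simp)).const_mul t)]
    refine integral_congr_ae (Eventually.of_forall fun x => ?_)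
    simp only [e1 x]; ring
  have f2 : ∫ x, marg₂ (tentPert F s t) x * ψ₂ x ∂μI =
      s * (∫ x, marg₂ (tentPert F 1 0) x * ψ₂ x ∂μI) +
        t * ∫ x, marg₂ (tentPert F 0 1) x * ψ₂ x ∂μI := by
    rw [← integral_const_mul, ← integral_const_mul,
      ← integral_add ((i2 1 0 (by simp)).const_mul s) ((i2 0 1 (by simp)).const_mul t)]
    refine integral_congr_ae (Eventually.of_forall fun x => ?_)
    simp only [e2 x]; ring
  rw [constraintVal, constraintVal, constraintVal, f1, f2]; ring

lemma exists_small_coeffs (α β : ℝ) :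
    ∃ s t : ℝ, (s ≠ 0 ∨ t ≠ 0) ∧ |s| + |t| ≤ 1 / 2 ∧ s * α + t * β = 0 := by
  by_cases h : α = 0 ∧ β = 0
  · exact ⟨1 / 2, 0, by norm_num, by norm_num [abs_of_pos], by rw [h.1]; ring⟩
  · have hpos : 0 < |α| + |β| := by
      rcases not_and_or.1 h with h | h
      · have := abs_pos.2 h; positivity
      · have := abs_pos.2 h; positivity
    set N := 2 * (|α| + |β|) with hN
    have hN0 : 0 < N := by positivity
    refine ⟨β / N, -α / N, ?_, ?_, by ring⟩
    · rcases not_and_or.1 h with h | h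
      · exact Or.inr (div_ne_zero (neg_ne_zero.2 h) hN0.ne')
      · exact Or.inl (div_ne_zero h hN0.ne')
    · rw [abs_div, abs_div, abs_neg, abs_of_pos hN0, ← add_div, div_le_iff₀ hN0]
      linarith

/-- For an extreme point, the first marginal of a monotone rationalization takes a single value on
the set of slices along which the rationalization is not `{0, 1}`-valued. -/
lemma ExtremePt2.exists_marg₁_eq {ψ₁ ψ₂ : ℝ → ℝ} {η : ℝ} {q : (ℝ → ℝ) × (ℝ → ℝ)}
    (hψ₁ : EssBdd ψ₁) (hψ₂ : EssBdd ψ₂) (hq : ExtremePt2 (constrainedQ2 ψ₁ ψ₂ η) q)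
    {F : ℝ × ℝ → ℝ} (hF : MonoUnit F) (hR : Rat2 F q.1 q.2) :
    ∃ m : ℝ, ∀ᵐ x ∂μI, marg₁ (fun z => tent (F z)) x = 0 ∨ marg₁ F x = m := by
  obtain ⟨s, t, hne, hst, h0⟩ := exists_small_coeffs
    (constraintVal ψ₁ ψ₂ (tentPert F 1 0)) (constraintVal ψ₁ ψ₂ (tentPert F 0 1))
  rw [← constraintVal_tentPert hψ₁ hψ₂ hF hR.aemeasurable] at h0
  have hk := hq.marg_eq_zero hψ₁ hψ₂ hF hR (aemeasurable_tentPert hF hR.aemeasurable s t)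
    (fun z => ⟨(abs_tentPert_le hF (by linarith) z).trans (tent_le _).1,
      (abs_tentPert_le hF (by linarith) z).trans (tent_le _).2⟩)
    (tentPert_dominated_fst hF hst) (tentPert_dominated_snd hF hst) h0
  refine ⟨-s / t, ?_⟩
  filter_upwards [hk.1] with x hx
  rw [marg₁_tentPert] at hx
  rcases mul_eq_zero.1 hx with h | h
  · right
    have ht : t ≠ 0 := by
      rintro rfl
      rcases hne with h' | h'
      · apply h'; linarith
      · exact h' rfl
    rw [eq_div_iff ht]; linarith
  · exact Or.inl h

/-- The abscissae in `[0, 1]` whose slices are not `{0, 1}`-valued and have integral `m`. -/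
def fracSlices (F : ℝ × ℝ → ℝ) (m : ℝ) : Set ℝ :=
  {x | x ∈ Icc (0 : ℝ) 1 ∧ marg₁ (fun z => tent (F z)) x ≠ 0 ∧ marg₁ F x = m}

lemma MonoUnit.slice_ae_eq {F : ℝ × ℝ → ℝ} (hF : MonoUnit F) {x x' : ℝ}
    (h : marg₁ F x = marg₁ F x') : ∀ᵐ y ∂μI, F (x, y) = F (x', y) := by
  wlog hx : x ≤ x' generalizing x x'
  · filter_upwards [this h.symm (le_of_not_ge hx)] with y hy using hy.symm
  exact (integral_eq_iff_of_ae_le (hF.integrable_fst x) (hF.integrable_fst x')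
    (Eventually.of_forall fun y => hF.mono (Prod.mk_le_mk.2 ⟨hx, le_rfl⟩))).1 h

lemma fracSlices_slice_ae_eq {F : ℝ × ℝ → ℝ} (hF : MonoUnit F) {m x x' : ℝ}
    (hx : x ∈ fracSlices F m) (hx' : x' ∈ fracSlices F m) : ∀ᵐ y ∂μI, F (x, y) = F (x', y) :=
  hF.slice_ae_eq (hx.2.2.trans hx'.2.2.symm)

lemma ordConnected_fracSlices {F : ℝ × ℝ → ℝ} (hF : MonoUnit F) (m : ℝ) :
    (fracSlices F m).OrdConnected := by
  refine ⟨fun x hx x' hx' t ht => ?_⟩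
  have hm : marg₁ F t = m := le_antisymm (hx'.2.2 ▸ hF.marg₁_mono ht.2)
    (hx.2.2 ▸ hF.marg₁_mono ht.1)
  refine ⟨⟨hx.1.1.trans ht.1, ht.2.trans hx'.1.2⟩, ?_, hm⟩
  have : marg₁ (fun z => tent (F z)) t = marg₁ (fun z => tent (F z)) x := by
    refine integral_congr_ae ?_
    filter_upwards [hF.slice_ae_eq (hm.trans hx.2.2.symm)] with y hy
    simp only [hy]
  rw [this]; exact hx.2.1

lemma measurableSet_fracSlices {F : ℝ × ℝ → ℝ} (hF : MonoUnit F) (m : ℝ) :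
    MeasurableSet (fracSlices F m) :=
  (ordConnected_fracSlices hF m).measurableSet

lemma tent_ae_eq_zero {F : ℝ × ℝ → ℝ} (hF : MonoUnit F) {x : ℝ}
    (h : marg₁ (fun z => tent (F z)) x = 0) : ∀ᵐ y ∂μI, tent (F (x, y)) = 0 :=
  (integral_eq_zero_iff_of_nonneg (fun _ => tent_nonneg (hF.mem _)) (hF.integrable_tent_fst x)).1 h

lemma ae_tent_eq_zero_or_mem {F : ℝ × ℝ → ℝ} (hF : MonoUnit F)
    (hm : AEMeasurable F ((μI).prod μI)) {m : ℝ}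
    (h : ∀ᵐ x ∂μI, marg₁ (fun z => tent (F z)) x = 0 ∨ marg₁ F x = m) :
    ∀ᵐ z ∂((μI).prod μI), tent (F z) = 0 ∨ z.1 ∈ fracSlices F m := by
  refine ae_prod_of_ae_ae ?_ ?_
  · exact ((measurable_tent.comp_aemeasurable hm).nullMeasurable (measurableSet_singleton 0)).union
      (measurable_fst (measurableSet_fracSlices hF m)).nullMeasurableSet
  · filter_upwards [h, ae_mem_unitInterval] with x hx hxI
    by_cases h0 : marg₁ (fun z => tent (F z)) x = 0
    · filter_upwards [tent_ae_eq_zero hF h0] with y hy using Or.inl hy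
    · exact Eventually.of_forall fun y => Or.inr ⟨hxI, h0, hx.resolve_left h0⟩

lemma ae_slice_eq {F : ℝ × ℝ → ℝ} (hF : MonoUnit F) (hm : AEMeasurable F ((μI).prod μI))
    {m x₀ : ℝ} (hx₀ : x₀ ∈ fracSlices F m) :
    ∀ᵐ z ∂((μI).prod μI), z.1 ∈ fracSlices F m → F z = F (x₀, z.2) := by
  refine ae_prod_of_ae_ae ?_ (Eventually.of_forall fun x => ?_)
  · simp only [imp_iff_not_or]
    exact (measurable_fst (measurableSet_fracSlices hF m)).compl.nullMeasurableSet.union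
      (nullMeasurableSet_eq_fun hm ((hF.measurable_fst x₀).comp measurable_snd).aemeasurable)
  · by_cases hx : x ∈ fracSlices F m
    · filter_upwards [fracSlices_slice_ae_eq hF hx hx₀] with y hy _ using hy
    · exact Eventually.of_forall fun y h => absurd h hx

lemma ae_mem_iff_mem_Icc {X : Set ℝ} (hX : X.OrdConnected) (hXI : X ⊆ Icc 0 1)
    (hne : X.Nonempty) : ∀ᵐ x ∂μI, x ∈ X ↔ x ∈ Icc (sInf X) (sSup X) := by
  have hb : BddBelow X := ⟨0, fun x hx => (hXI hx).1⟩
  have ha : BddAbove X := ⟨1, fun x hx => (hXI hx).2⟩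
  have h1 : ∀ᵐ x ∂(volume : Measure ℝ), x ≠ sInf X := by simp [ae_iff]
  have h2 : ∀ᵐ x ∂(volume : Measure ℝ), x ≠ sSup X := by simp [ae_iff]
  filter_upwards [ae_restrict_of_ae h1, ae_restrict_of_ae h2] with x hx hx'
  refine ⟨fun h => subset_Icc_csInf_csSup hb ha h, fun h => ?_⟩
  exact IsConnected.Ioo_csInf_csSup_subset ⟨hne, hX.isPreconnected⟩ hb ha
    ⟨lt_of_le_of_ne h.1 (Ne.symm hx), lt_of_le_of_ne h.2 hx'⟩

lemma Icc_csInf_csSup_subset {X : Set ℝ} (hXI : X ⊆ Icc 0 1) (hne : X.Nonempty) :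
    Icc (sInf X) (sSup X) ⊆ Icc 0 1 :=
  Icc_subset_Icc (le_csInf hne fun _ hx => (hXI hx).1) (csSup_le hne fun _ hx => (hXI hx).2)

/-- A `{0, 1}`-valued outside of `X ×ˢ Y` monotone function takes a single value on `X ×ˢ Y`. -/
lemma exists_const_on_fracSlices {F : ℝ × ℝ → ℝ} (hF : MonoUnit F)
    (hm : AEMeasurable F ((μI).prod μI)) {m₁ m₂ : ℝ}
    (h₁ : ∀ᵐ x ∂μI, marg₁ (fun z => tent (F z)) x = 0 ∨ marg₁ F x = m₁)
    (h₂ : ∀ᵐ y ∂μI, marg₁ (fun z => tent (F z.swap)) y = 0 ∨ marg₁ (fun z => F z.swap) y = m₂)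
    (hne : ¬ ∀ᵐ z ∂((μI).prod μI), tent (F z) = 0) :
    ∃ lam : ℝ, 0 < lam ∧ lam < 1 ∧ (fracSlices F m₁).Nonempty ∧
      (fracSlices (fun z => F z.swap) m₂).Nonempty ∧
      ∀ᵐ z ∂((μI).prod μI),
        (z.1 ∈ fracSlices F m₁ ∧ z.2 ∈ fracSlices (fun z => F z.swap) m₂ ∧ F z = lam) ∨
        (¬ (z.1 ∈ fracSlices F m₁ ∧ z.2 ∈ fracSlices (fun z => F z.swap) m₂) ∧
          (F z = 0 ∨ F z = 1)) := by
  set X := fracSlices F m₁ with hX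
  set Y := fracSlices (fun z => F z.swap) m₂ with hY
  have hms := aemeasurable_swap hm
  have hX0 := ae_tent_eq_zero_or_mem hF hm h₁
  have hY0 : ∀ᵐ z ∂((μI).prod μI), tent (F z) = 0 ∨ z.2 ∈ Y := by
    simpa using ae_prod_swap (ae_tent_eq_zero_or_mem hF.swap hms h₂)
  obtain ⟨z₀, hz₀, hzX, hzY⟩ : ∃ z₀ : ℝ × ℝ, tent (F z₀) ≠ 0 ∧ z₀.1 ∈ X ∧ z₀.2 ∈ Y := by
    by_contra! hcon
    refine hne ?_
    filter_upwards [hX0, hY0] with z h1 h2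
    by_contra h0
    exact hcon z h0 (h1.resolve_left h0) (h2.resolve_left h0)
  have hFX := ae_slice_eq hF hm hzX
  have hFY : ∀ᵐ z ∂((μI).prod μI), z.2 ∈ Y → F z = F (z.1, z₀.2) := by
    simpa using ae_prod_swap (ae_slice_eq hF.swap hms hzY)
  obtain ⟨x₁, hx₁⟩ : ∃ x₁, ∀ᵐ y ∂μI, y ∈ Y → F (z₀.1, y) = F (x₁, z₀.2) := by
    by_contra hcon
    have h3 : ∀ᵐ x ∂μI, x ∉ X := by
      filter_upwards [Measure.ae_ae_of_ae_prod hFX, Measure.ae_ae_of_ae_prod hFY] with x hx hx' hxX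
      refine hcon ⟨x, ?_⟩
      filter_upwards [hx, hx'] with y hy hy' hyY
      rw [← hy hxX, hy' hyY]
    refine hne ?_
    filter_upwards [hX0, Measure.quasiMeasurePreserving_fst.ae h3] with z h4 h5
    exact h4.resolve_right h5
  set lam := F (x₁, z₀.2) with hlam
  have hmain : ∀ᵐ z ∂((μI).prod μI), (z.1 ∈ X ∧ z.2 ∈ Y ∧ F z = lam) ∨
      (¬ (z.1 ∈ X ∧ z.2 ∈ Y) ∧ (F z = 0 ∨ F z = 1)) := by
    filter_upwards [hX0, hY0, hFX, Measure.quasiMeasurePreserving_snd.ae hx₁] with z h3 h4 h5 h6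
    by_cases hz : z.1 ∈ X ∧ z.2 ∈ Y
    · exact Or.inl ⟨hz.1, hz.2, (h5 hz.1).trans (h6 hz.2)⟩
    · refine Or.inr ⟨hz, tent_eq_zero ?_⟩
      by_contra h0
      exact hz ⟨h3.resolve_left h0, h4.resolve_left h0⟩
  have hlam0 : tent lam ≠ 0 := by
    intro h0
    refine hne ?_
    filter_upwards [hmain] with z hz
    rcases hz with ⟨-, -, h⟩ | ⟨-, h | h⟩
    · rw [h, h0]
    · rw [h]; norm_num [tent]
    · rw [h]; norm_num [tent]
  have hl := hF.mem (x₁, z₀.2)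
  refine ⟨lam, lt_of_le_of_ne hl.1 fun h => ?_, lt_of_le_of_ne hl.2 fun h => ?_, ⟨_, hzX⟩,
    ⟨_, hzY⟩, hmain⟩
  · apply hlam0; rw [← h]; norm_num [tent]
  · apply hlam0; rw [show lam = 1 from h]; norm_num [tent]

lemma upSet2_superlevel {F : ℝ × ℝ → ℝ} (hF : MonoUnit F) (c : ℝ) :
    UpSet2 {z | z ∈ unitSq ∧ c ≤ F z} :=
  ⟨fun _ hz => hz.1, fun _ hx _ hy hxy => ⟨hy, hx.2.trans (hF.mono hxy)⟩⟩

/-- A monotone rationalization whose slices that are not `{0, 1}`-valued have constant integral is a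
mixture of indicators of nested up-sets that differ by a rectangle. -/
lemma exists_upSets_of_fracSlices {F : ℝ × ℝ → ℝ} {q₁ q₂ : ℝ → ℝ} (hF : MonoUnit F)
    (hR : Rat2 F q₁ q₂) {m₁ m₂ : ℝ}
    (h₁ : ∀ᵐ x ∂μI, marg₁ (fun z => tent (F z)) x = 0 ∨ marg₁ F x = m₁)
    (h₂ : ∀ᵐ y ∂μI, marg₁ (fun z => tent (F z.swap)) y = 0 ∨ marg₁ (fun z => F z.swap) y = m₂) :
    ∃ (A A' : Set (ℝ × ℝ)) (lam a b c d : ℝ),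
      UpSet2 A ∧ UpSet2 A' ∧ A' ⊆ A ∧ lam ∈ Set.Icc (0 : ℝ) 1 ∧
      volume (((A \ A') \ (Set.Icc a b ×ˢ Set.Icc c d)) ∪
        ((Set.Icc a b ×ˢ Set.Icc c d) \ (A \ A'))) = 0 ∧
      Rat2 (fun x => lam * A.indicator 1 x + (1 - lam) * A'.indicator 1 x) q₁ q₂ := by
  by_cases hne : ∀ᵐ z ∂((μI).prod μI), tent (F z) = 0
  · refine ⟨{z | z ∈ unitSq ∧ 1 ≤ F z}, {z | z ∈ unitSq ∧ 1 ≤ F z}, 1, 1, 0, 1, 0,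
      upSet2_superlevel hF 1, upSet2_superlevel hF 1, subset_rfl, by norm_num, by simp, ?_⟩
    refine hR.congr (fun z _ => ?_) ?_
    · by_cases hz : z ∈ {z | z ∈ unitSq ∧ 1 ≤ F z}
      · simp only [indicator_of_mem hz]; norm_num
      · simp only [indicator_of_notMem hz]; norm_num
    · filter_upwards [hne, ae_mem_unitSq] with z hz hzS
      rcases tent_eq_zero hz with h | h <;> simp [indicator, hzS, h]
  obtain ⟨lam, hl0, hl1, hXne, hYne, hae⟩ :=
    exists_const_on_fracSlices hF hR.aemeasurable h₁ h₂ hne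
  set X := fracSlices F m₁ with hX
  set Y := fracSlices (fun z => F z.swap) m₂ with hY
  have hXI : X ⊆ Icc 0 1 := fun x hx => hx.1
  have hYI : Y ⊆ Icc 0 1 := fun x hx => hx.1
  have hXae : ∀ᵐ z ∂((μI).prod μI), z.1 ∈ X ↔ z.1 ∈ Icc (sInf X) (sSup X) :=
    Measure.quasiMeasurePreserving_fst.ae <|
      ae_mem_iff_mem_Icc (ordConnected_fracSlices hF m₁) hXI hXne
  have hYae : ∀ᵐ z ∂((μI).prod μI), z.2 ∈ Y ↔ z.2 ∈ Icc (sInf Y) (sSup Y) :=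
    Measure.quasiMeasurePreserving_snd.ae <|
      ae_mem_iff_mem_Icc (ordConnected_fracSlices hF.swap m₂) hYI hYne
  have hsub : {z | z ∈ unitSq ∧ 1 ≤ F z} ⊆ {z | z ∈ unitSq ∧ lam ≤ F z} :=
    fun z hz => ⟨hz.1, hl1.le.trans hz.2⟩
  refine ⟨{z | z ∈ unitSq ∧ lam ≤ F z}, {z | z ∈ unitSq ∧ 1 ≤ F z}, lam, sInf X, sSup X, sInf Y,
    sSup Y, upSet2_superlevel hF lam, upSet2_superlevel hF 1, hsub, ⟨hl0.le, hl1.le⟩, ?_, ?_⟩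
  · have hS : Icc (sInf X) (sSup X) ×ˢ Icc (sInf Y) (sSup Y) ⊆ unitSq := by
      rw [unitSq_eq_prod]
      exact prod_mono (Icc_csInf_csSup_subset hXI hXne) (Icc_csInf_csSup_subset hYI hYne)
    rw [← Measure.restrict_eq_self volume (t := unitSq)
      (union_subset (fun z hz => hz.1.1.1) fun z hz => hS hz.1), volume_restrict_unitSq]
    rw [measure_eq_zero_iff_ae_notMem]
    filter_upwards [hae, hXae, hYae, ae_mem_unitSq] with z hz h3 h4 hzS
    have h5 : z ∈ Icc (sInf X) (sSup X) ×ˢ Icc (sInf Y) (sSup Y) ↔ z.1 ∈ X ∧ z.2 ∈ Y := by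
      rw [mem_prod, ← h3, ← h4]
    have h6 : z ∈ {z | z ∈ unitSq ∧ lam ≤ F z} \ {z | z ∈ unitSq ∧ 1 ≤ F z} ↔
        lam ≤ F z ∧ F z < 1 := by
      simp [hzS]
    rw [mem_union, Set.mem_sdiff, Set.mem_sdiff _ (s := Icc _ _ ×ˢ _), h5, h6]
    rcases hz with ⟨h7, h8, h9⟩ | ⟨h7, h8 | h8⟩
    · simp [h7, h8, h9, hl1]
    · simp [h7, h8, hl0]
    · simp [h7, h8]
  · refine hR.congr (fun z _ => ?_) ?_
    · by_cases hz : z ∈ {z | z ∈ unitSq ∧ 1 ≤ F z}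
      · simp only [indicator_of_mem hz, indicator_of_mem (hsub hz)]; norm_num
      · by_cases hz' : z ∈ {z | z ∈ unitSq ∧ lam ≤ F z}
        · simp only [indicator_of_notMem hz, indicator_of_mem hz', Pi.one_apply]
          constructor <;> linarith
        · simp only [indicator_of_notMem hz, indicator_of_notMem hz']; norm_num
    · filter_upwards [hae, ae_mem_unitSq] with z hz hzS
      rcases hz with ⟨-, -, h⟩ | ⟨-, h | h⟩
      · simp [indicator, hzS, h, hl1]
      · simp [indicator, hzS, h, hl0.not_ge, (zero_lt_one (α := ℝ)).not_ge]
      · simp [indicator, hzS, h, hl1.le]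

lemma constrainedQ2_swap {ψ₁ ψ₂ : ℝ → ℝ} {η : ℝ} {p : (ℝ → ℝ) × (ℝ → ℝ)}
    (h : p ∈ constrainedQ2 ψ₁ ψ₂ η) : p.swap ∈ constrainedQ2 ψ₂ ψ₁ η :=
  ⟨⟨h.1.2.1, h.1.1, h.1.2.2.elim fun _ hf => ⟨_, hf.swap⟩⟩, (add_comm _ _).trans_le h.2⟩

lemma ExtremePt2.swap {ψ₁ ψ₂ : ℝ → ℝ} {η : ℝ} {q : (ℝ → ℝ) × (ℝ → ℝ)}
    (h : ExtremePt2 (constrainedQ2 ψ₁ ψ₂ η) q) : ExtremePt2 (constrainedQ2 ψ₂ ψ₁ η) q.swap := by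
  refine ⟨constrainedQ2_swap h.1, fun q' hq' q'' hq'' l hl hl' heq t ht => ?_⟩
  exact (h.2 _ (constrainedQ2_swap hq') _ (constrainedQ2_swap hq'') l hl hl'
    (fun t ht => (heq t ht).symm) t ht).symm

/-- Projection of the plane onto the unit square. -/
def clampSq (z : ℝ × ℝ) : ℝ × ℝ := (max 0 (min 1 z.1), max 0 (min 1 z.2))

lemma clampSq_mem (z : ℝ × ℝ) : clampSq z ∈ unitSq := by
  rw [mem_unitSq_iff]
  exact ⟨⟨le_max_left _ _, max_le zero_le_one (min_le_left _ _)⟩,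
    ⟨le_max_left _ _, max_le zero_le_one (min_le_left _ _)⟩⟩

lemma clampSq_of_mem {z : ℝ × ℝ} (hz : z ∈ unitSq) : clampSq z = z := by
  rw [mem_unitSq_iff] at hz
  simp [clampSq, hz.1.1, hz.1.2, hz.2.1, hz.2.2]

lemma monotone_clampSq : Monotone clampSq := fun _ _ h =>
  Prod.mk_le_mk.2 ⟨max_le_max le_rfl (min_le_min le_rfl h.1),
    max_le_max le_rfl (min_le_min le_rfl h.2)⟩

lemma Rat2.exists_monoUnit {f : ℝ × ℝ → ℝ} {q₁ q₂ : ℝ → ℝ} (hR : Rat2 f q₁ q₂)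
    (hf : ∀ x ∈ unitSq, ∀ y ∈ unitSq, x ≤ y → f x ≤ f y) :
    ∃ F, MonoUnit F ∧ Rat2 F q₁ q₂ ∧ f =ᵐ[(μI).prod μI] F := by
  have h : f =ᵐ[(μI).prod μI] fun z => f (clampSq z) := by
    filter_upwards [ae_mem_unitSq] with z hz
    rw [clampSq_of_mem hz]
  exact ⟨_, ⟨fun _ _ hab => hf _ (clampSq_mem _) _ (clampSq_mem _) (monotone_clampSq hab),
    fun z => hR.2.1 _ (clampSq_mem z)⟩, hR.congr (fun z _ => hR.2.1 _ (clampSq_mem z)) h, h⟩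

lemma eq_of_half_add_eq {a b c d : ℝ} (h : (a + b) / 2 = (c + d) / 2) (hac : a ≤ c) (hbd : b ≤ d) :
    a = c ∧ b = d := by
  constructor <;> linarith

/-- Two monotone rationalizations of an extreme point coincide almost everywhere. -/
lemma ExtremePt2.monoUnit_ae_eq {ψ₁ ψ₂ : ℝ → ℝ} {η : ℝ} {q : (ℝ → ℝ) × (ℝ → ℝ)}
    (hψ₁ : EssBdd ψ₁) (hψ₂ : EssBdd ψ₂) (hq : ExtremePt2 (constrainedQ2 ψ₁ ψ₂ η) q)
    {F G : ℝ × ℝ → ℝ} (hF : MonoUnit F) (hG : MonoUnit G) (hFR : Rat2 F q.1 q.2)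
    (hGR : Rat2 G q.1 q.2) : F =ᵐ[(μI).prod μI] G := by
  set H : ℝ × ℝ → ℝ := fun z => (F z + G z) / 2 with hH
  have hHM : MonoUnit H := by
    refine ⟨fun a b hab => ?_, fun z => ?_⟩
    · simp only [hH]; linarith [hF.mono hab, hG.mono hab]
    · have h1 := hF.mem z; have h2 := hG.mem z
      simp only [hH]
      constructor <;> linarith [h1.1, h1.2, h2.1, h2.2]
  have hmarg : ∀ x, marg₁ H x = (marg₁ F x + marg₁ G x) / 2 := fun x => by
    simp only [marg₁, hH]
    rw [integral_div, integral_add (hF.integrable_fst x) (hG.integrable_fst x)]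
  have hmarg' : ∀ x, marg₁ (fun z => H z.swap) x =
      (marg₁ (fun z => F z.swap) x + marg₁ (fun z => G z.swap) x) / 2 := fun x => by
    simp only [marg₁, hH]
    rw [integral_div, integral_add (hF.swap.integrable_fst x) (hG.swap.integrable_fst x)]
  have hHR : Rat2 H q.1 q.2 := by
    refine ⟨?_, fun z _ => hHM.mem z, ?_, ?_⟩
    · exact (hFR.1.add hGR.1).div_const 2
    · filter_upwards [hFR.2.2.1, hGR.2.2.1] with t h1 h2
      change _ = marg₁ F t at h1; change _ = marg₁ G t at h2; change _ = marg₁ H t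
      rw [hmarg]; linarith
    · filter_upwards [hFR.2.2.2, hGR.2.2.2] with t h1 h2
      change _ = marg₁ (fun z => F z.swap) t at h1
      change _ = marg₁ (fun z => G z.swap) t at h2
      change _ = marg₁ (fun z => H z.swap) t
      rw [hmarg']; linarith
  obtain ⟨m, hm⟩ := hq.exists_marg₁_eq hψ₁ hψ₂ hHM hHR
  have h0 := ae_tent_eq_zero_or_mem hHM hHR.aemeasurable hm
  have hext : ∀ z, tent (H z) = 0 → F z = G z := fun z hz => by
    have h1 := hF.mem z; have h2 := hG.mem z
    rcases tent_eq_zero hz with h | h <;> simp only [hH] at h <;>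
      linarith [h1.1, h1.2, h2.1, h2.2]
  set X := fracSlices H m with hX
  by_cases hXne : X.Nonempty
  swap
  · filter_upwards [h0] with z hz
    exact hext z (hz.resolve_right fun h => hXne ⟨_, h⟩)
  obtain ⟨x₀, hx₀⟩ := hXne
  have hXm : MeasurableSet X := measurableSet_fracSlices hHM m
  have hsl : ∀ x ∈ X, ∀ᵐ y ∂μI, F (x, y) = F (x₀, y) ∧ G (x, y) = G (x₀, y) := by
    intro x hx
    filter_upwards [fracSlices_slice_ae_eq hHM hx hx₀] with y hy
    rcases le_total x x₀ with h | h
    · exact eq_of_half_add_eq hy (hF.mono (Prod.mk_le_mk.2 ⟨h, le_rfl⟩))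
        (hG.mono (Prod.mk_le_mk.2 ⟨h, le_rfl⟩))
    · have := eq_of_half_add_eq hy.symm (hF.mono (Prod.mk_le_mk.2 ⟨h, le_rfl⟩))
        (hG.mono (Prod.mk_le_mk.2 ⟨h, le_rfl⟩))
      exact ⟨this.1.symm, this.2.symm⟩
  have hxall : ∀ᵐ x ∂μI, ∀ᵐ y ∂μI,
      F (x, y) - G (x, y) = X.indicator 1 x * (F (x₀, y) - G (x₀, y)) := by
    filter_upwards [Measure.ae_ae_of_ae_prod h0] with x hx
    by_cases hxX : x ∈ X
    · filter_upwards [hsl x hxX] with y hy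
      rw [indicator_of_mem hxX, hy.1, hy.2]; simp
    · filter_upwards [hx] with y hy
      rw [indicator_of_notMem hxX, hext _ (hy.resolve_right hxX)]; ring
  have hxprod : ∀ᵐ z ∂((μI).prod μI),
      F z - G z = X.indicator 1 z.1 * (F (x₀, z.2) - G (x₀, z.2)) := by
    refine ae_prod_of_ae_ae (nullMeasurableSet_eq_fun
      (hFR.aemeasurable.sub hGR.aemeasurable) (Measurable.aemeasurable ?_)) hxall
    exact ((measurable_one.indicator hXm).comp measurable_fst).mul
      (((hF.measurable_fst x₀).comp measurable_snd).sub
        ((hG.measurable_fst x₀).comp measurable_snd))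
  have hint : ∀ᵐ y ∂μI, (μI).real X * (F (x₀, y) - G (x₀, y)) = 0 := by
    filter_upwards [hFR.2.2.2, hGR.2.2.2, Measure.ae_ae_of_ae_prod (ae_prod_swap hxprod)]
      with y h1 h2 h3
    have h4 : ∫ x, (F (x, y) - G (x, y)) ∂μI = 0 :=
      (integral_sub (hF.swap.integrable_fst y) (hG.swap.integrable_fst y)).trans
        (sub_eq_zero.2 (h1.symm.trans h2))
    have h5 : ∫ x, (F (x, y) - G (x, y)) ∂μI =
        ∫ x, X.indicator 1 x * (F (x₀, y) - G (x₀, y)) ∂μI := integral_congr_ae h3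
    rwa [h4, integral_mul_const, integral_indicator_one hXm, eq_comm] at h5
  by_cases hX0 : (μI).real X = 0
  · have hX0' : ∀ᵐ x ∂μI, x ∉ X := by
      rwa [← measure_eq_zero_iff_ae_notMem, ← measureReal_eq_zero_iff]
    filter_upwards [h0, Measure.quasiMeasurePreserving_fst.ae hX0'] with z hz hz'
    exact hext z (hz.resolve_right hz')
  · filter_upwards [hxprod, Measure.quasiMeasurePreserving_snd.ae hint] with z hz hz'
    rw [(mul_eq_zero.1 hz').resolve_left hX0, mul_zero] at hz
    exact sub_eq_zero.1 hz

local notation "νI" => Measure.prod μI μI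

lemma setIntegral_prod_univ_right {f : ℝ × ℝ → ℝ} (hf : Integrable f νI) (T : Set ℝ) :
    ∫ z in T ×ˢ univ, f z ∂νI = ∫ x in T, marg₁ f x ∂μI := by
  rw [setIntegral_prod _ hf.integrableOn, Measure.restrict_univ]; rfl

lemma setIntegral_prod_univ_left {f : ℝ × ℝ → ℝ} (hf : Integrable f νI) (T : Set ℝ) :
    ∫ z in univ ×ˢ T, f z ∂νI = ∫ y in T, marg₂ f y ∂μI := by
  rw [← setIntegral_prod_swap]
  exact setIntegral_prod_univ_right hf.swap T

/-- The square-integrable functions on the unit square that rationalize `(q₁, q₂)`. -/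
def ratSet (q₁ q₂ : ℝ → ℝ) : Set (Lp ℝ 2 νI) :=
  {u | 0 ≤ u ∧ u ≤ Lp.const 2 νI (1 : ℝ) ∧
    (∀ T, MeasurableSet T → ∫ z in T ×ˢ univ, u z ∂νI = ∫ t in T, q₁ t ∂μI) ∧
    ∀ T, MeasurableSet T → ∫ z in univ ×ˢ T, u z ∂νI = ∫ t in T, q₂ t ∂μI}

lemma continuous_setIntegral_L2 {S : Set (ℝ × ℝ)} (hS : MeasurableSet S) :
    Continuous fun u : Lp ℝ 2 νI => ∫ z in S, u z ∂νI := by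
  have : (fun u : Lp ℝ 2 νI => ∫ z in S, u z ∂νI) =
      fun u => inner ℝ (indicatorConstLp 2 hS (measure_ne_top νI S) (1 : ℝ)) u := by
    ext u; rw [L2.inner_indicatorConstLp_one]
  rw [this]
  fun_prop

lemma isClosed_ratSet (q₁ q₂ : ℝ → ℝ) : IsClosed (ratSet q₁ q₂) := by
  simp only [ratSet, ofPred_and, ofPred_forall]
  refine isClosed_Ici.inter (isClosed_Iic.inter (IsClosed.inter ?_ ?_)) <;>
    refine isClosed_iInter fun T => isClosed_iInter fun hT => isClosed_eq ?_ continuous_const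
  · exact continuous_setIntegral_L2 (hT.prod .univ)
  · exact continuous_setIntegral_L2 (MeasurableSet.univ.prod hT)

lemma convex_ratSet (q₁ q₂ : ℝ → ℝ) : Convex ℝ (ratSet q₁ q₂) := by
  have key : ∀ (S : Set (ℝ × ℝ)) (hS : MeasurableSet S) (c : ℝ),
      Convex ℝ {u : Lp ℝ 2 νI | ∫ z in S, u z ∂νI = c} := by
    intro S hS c u hu v hv a b _ _ hab
    simp only [mem_ofPred_eq, ← L2.inner_indicatorConstLp_one hS (measure_ne_top νI S)] at hu hv ⊢
    rw [inner_add_right, inner_smul_right, inner_smul_right, hu, hv, ← add_mul, hab, one_mul]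
  have : PosSMulMono ℝ (Lp ℝ 2 νI) := by
    refine ⟨fun a ha u v huv => ?_⟩
    rw [← Lp.coeFn_le] at huv ⊢
    filter_upwards [huv, Lp.coeFn_smul a u, Lp.coeFn_smul a v] with z h h1 h2
    rw [h1, h2]
    exact mul_le_mul_of_nonneg_left h ha
  simp only [ratSet, ofPred_and, ofPred_forall]
  refine (convex_Ici _).inter ((convex_Iic _).inter (Convex.inter ?_ ?_)) <;>
    refine convex_iInter fun T => convex_iInter fun hT => key _ ?_ _
  · exact hT.prod .univ
  · exact MeasurableSet.univ.prod hT

lemma Rat2.memLp {f : ℝ × ℝ → ℝ} {q₁ q₂ : ℝ → ℝ} (h : Rat2 f q₁ q₂) : MemLp f 2 νI :=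
  MemLp.of_bound h.aemeasurable.aestronglyMeasurable 1 (by
    filter_upwards [h.ae_mem] with z hz
    rw [Real.norm_eq_abs, abs_of_nonneg hz.1]; exact hz.2)

lemma Rat2.toLp_mem_ratSet {f : ℝ × ℝ → ℝ} {q₁ q₂ : ℝ → ℝ} (h : Rat2 f q₁ q₂) :
    h.memLp.toLp f ∈ ratSet q₁ q₂ := by
  have hf := h.memLp.coeFn_toLp
  refine ⟨?_, ?_, fun T hT => ?_, fun T hT => ?_⟩
  · rw [← Lp.coeFn_nonneg]
    filter_upwards [hf, h.ae_mem] with z hz hz'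
    rw [hz]; exact hz'.1
  · rw [← Lp.coeFn_le]
    filter_upwards [hf, h.ae_mem, Lp.coeFn_const (p := 2) (μ := νI) (c := (1 : ℝ))] with z hz hz' h1
    rw [hz, h1]; exact hz'.2
  · rw [integral_congr_ae (ae_restrict_of_ae hf), setIntegral_prod_univ_right h.integrable]
    exact integral_congr_ae (ae_restrict_of_ae (h.2.2.1.mono fun t ht => ht.symm))
  · rw [integral_congr_ae (ae_restrict_of_ae hf), setIntegral_prod_univ_left h.integrable]
    exact integral_congr_ae (ae_restrict_of_ae (h.2.2.2.mono fun t ht => ht.symm))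

lemma exists_rat2_of_mem_ratSet {q₁ q₂ : ℝ → ℝ} (hq₁ : Integrable q₁ μI) (hq₂ : Integrable q₂ μI)
    {u : Lp ℝ 2 νI} (hu : u ∈ ratSet q₁ q₂) :
    ∃ f : ℝ × ℝ → ℝ, Measurable f ∧ (∀ z, f z ∈ Icc (0 : ℝ) 1) ∧ Rat2 f q₁ q₂ ∧ u =ᵐ[νI] f := by
  obtain ⟨h0, h1, hT₁, hT₂⟩ := hu
  have hum : Measurable u := (Lp.stronglyMeasurable u).measurable
  have hmem : ∀ z, max 0 (min 1 (u z)) ∈ Icc (0 : ℝ) 1 := fun z =>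
    ⟨le_max_left _ _, max_le zero_le_one (min_le_left _ _)⟩
  have hfm : Measurable fun z => max 0 (min 1 (u z)) :=
    measurable_const.max (measurable_const.min hum)
  have hae : u =ᵐ[νI] fun z => max 0 (min 1 (u z)) := by
    rw [← Lp.coeFn_nonneg] at h0
    rw [← Lp.coeFn_le] at h1
    filter_upwards [h0, h1, Lp.coeFn_const (p := 2) (μ := νI) (c := (1 : ℝ))] with z hz hz' h1
    rw [h1] at hz'
    have hz0 : 0 ≤ u z := hz
    have hz1 : u z ≤ 1 := hz'
    rw [min_eq_right hz1, max_eq_right hz0]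
  have hfi : Integrable (fun z => max 0 (min 1 (u z))) νI :=
    integrable_of_mem_Icc_s10 hfm.aemeasurable 1 (Eventually.of_forall fun z => by
      rw [abs_of_nonneg (hmem z).1]; exact (hmem z).2)
  refine ⟨_, hfm, hmem, ⟨hfm.aemeasurable, fun z _ => hmem z, ?_, ?_⟩, hae⟩
  · refine hq₁.ae_eq_of_forall_setIntegral_eq _ _ hfi.integral_prod_left fun T hT _ => ?_
    rw [← hT₁ T hT, integral_congr_ae (ae_restrict_of_ae hae), setIntegral_prod_univ_right hfi]
    rfl
  · refine hq₂.ae_eq_of_forall_setIntegral_eq _ _ hfi.integral_prod_right fun T hT _ => ?_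
    rw [← hT₂ T hT, integral_congr_ae (ae_restrict_of_ae hae), setIntegral_prod_univ_left hfi]
    rfl

/-- `f` is a rationalization of `(q₁, q₂)` of least `L²` norm. -/
structure MinRat (f : ℝ × ℝ → ℝ) (q₁ q₂ : ℝ → ℝ) : Prop where
  measurable : Measurable f
  mem : ∀ z, f z ∈ Icc (0 : ℝ) 1
  rat : Rat2 f q₁ q₂
  minimal : ∀ w, Rat2 w q₁ q₂ → 0 ≤ ∫ z, f z * (w z - f z) ∂νI

lemma MinRat.swap {f : ℝ × ℝ → ℝ} {q₁ q₂ : ℝ → ℝ} (h : MinRat f q₁ q₂) :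
    MinRat (fun z => f z.swap) q₂ q₁ := by
  refine ⟨h.measurable.comp measurable_swap, fun z => h.mem _, h.rat.swap, fun w hw => ?_⟩
  refine (h.minimal _ hw.swap).trans_eq ?_
  rw [← integral_prod_swap]
  simp only [Prod.swap_swap]

lemma Rat2.integrable_fst_snd {f : ℝ × ℝ → ℝ} {q₁ q₂ : ℝ → ℝ} (h : Rat2 f q₁ q₂) :
    Integrable q₁ μI ∧ Integrable q₂ μI :=
  ⟨h.integrable.integral_prod_left.congr (h.2.2.1.mono fun _ ht => ht.symm),
    h.integrable.integral_prod_right.congr (h.2.2.2.mono fun _ ht => ht.symm)⟩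

lemma Rat2.exists_minRat {f : ℝ × ℝ → ℝ} {q₁ q₂ : ℝ → ℝ} (h : Rat2 f q₁ q₂) :
    ∃ g, MinRat g q₁ q₂ := by
  obtain ⟨u, hu, humin⟩ := exists_norm_eq_iInf_of_complete_convex ⟨_, h.toLp_mem_ratSet⟩
    (isClosed_ratSet q₁ q₂).isComplete (convex_ratSet q₁ q₂) 0
  rw [norm_eq_iInf_iff_real_inner_le_zero (convex_ratSet q₁ q₂) hu] at humin
  obtain ⟨g, hgm, hg, hgR, hug⟩ :=
    exists_rat2_of_mem_ratSet h.integrable_fst_snd.1 h.integrable_fst_snd.2 hu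
  refine ⟨g, hgm, hg, hgR, fun w hw => ?_⟩
  have h1 := humin _ hw.toLp_mem_ratSet
  rw [zero_sub, inner_neg_left, neg_nonpos, L2.inner_def] at h1
  refine h1.trans_eq (integral_congr_ae ?_)
  filter_upwards [hug, hw.memLp.coeFn_toLp, Lp.coeFn_sub (hw.memLp.toLp w) u] with z h2 h3 h4
  rw [h4, Pi.sub_apply, h3, h2]
  simp [mul_comm]

lemma integral_shift {g : ℝ → ℝ} {τ : ℝ} (hτ : 0 ≤ τ) (hg : ∀ x ∉ Icc 0 (1 - τ), g x = 0) :
    ∫ x, g (x - τ) ∂μI = ∫ x, g x ∂μI := by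
  rw [setIntegral_eq_integral_of_forall_compl_eq_zero fun x hx => hg _ fun h => hx
      (mem_Icc.2 ⟨by linarith [h.1], by linarith [h.2]⟩),
    setIntegral_eq_integral_of_forall_compl_eq_zero fun x hx => hg _ fun h => hx
      (mem_Icc.2 ⟨h.1, by linarith [h.2]⟩), integral_sub_right_eq_self g τ]

lemma integrable_of_abs_le_one {f : ℝ × ℝ → ℝ} (hf : Measurable f) (h : ∀ z, |f z| ≤ 1) :
    Integrable f νI :=
  integrable_of_mem_Icc_s10 hf.aemeasurable 1 (Eventually.of_forall h)

lemma integral_prod_shift {g : ℝ × ℝ → ℝ} {τ : ℝ} (hτ : 0 ≤ τ) (hgm : Measurable g)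
    (hgb : ∀ z, |g z| ≤ 1) (hg : ∀ z : ℝ × ℝ, z.1 ∉ Icc 0 (1 - τ) → g z = 0) :
    ∫ z, g (z.1 - τ, z.2) ∂νI = ∫ z, g z ∂νI := by
  have hm : Measurable fun z : ℝ × ℝ => g (z.1 - τ, z.2) := hgm.comp (by fun_prop)
  rw [integral_prod_symm _ (integrable_of_abs_le_one hm fun z => hgb _),
    integral_prod_symm _ (integrable_of_abs_le_one hgm hgb)]
  exact integral_congr_ae (Eventually.of_forall fun y =>
    integral_shift (g := fun x => g (x, y)) hτ fun x hx => hg _ hx)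

/-- A transfer of mass between `f` and its horizontal translate. -/
lemma MinRat.integral_mul_le {f h : ℝ × ℝ → ℝ} {q₁ q₂ : ℝ → ℝ} (hf : MinRat f q₁ q₂) {τ : ℝ}
    (hτ : 0 ≤ τ) (hm : Measurable h) (h0 : ∀ z : ℝ × ℝ, z.1 ∉ Icc 0 (1 - τ) → h z = 0)
    (h1 : ∀ z : ℝ × ℝ, h z ≤ max (f z - f (z.1 + τ, z.2)) 0)
    (h2 : ∀ z : ℝ × ℝ, -h z ≤ max (f (z.1 + τ, z.2) - f z) 0)
    (hmarg : ∀ x, marg₁ h x = 0) :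
    ∫ z, h z * (f z - f (z.1 + τ, z.2)) ∂νI ≤ 0 := by
  have hup : ∀ z, h z ≤ f z ∧ h z ≤ 1 - f (z.1 + τ, z.2) := fun z => by
    have ha := hf.mem z; have hb := hf.mem (z.1 + τ, z.2)
    exact ⟨(h1 z).trans (max_le (by linarith [hb.1]) ha.1),
      (h1 z).trans (max_le (by linarith [ha.2]) (by linarith [hb.2]))⟩
  have hlo : ∀ z, -h z ≤ 1 - f z ∧ -h z ≤ f (z.1 + τ, z.2) := fun z => by
    have ha := hf.mem z; have hb := hf.mem (z.1 + τ, z.2)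
    exact ⟨(h2 z).trans (max_le (by linarith [hb.2]) (by linarith [ha.2])),
      (h2 z).trans (max_le (by linarith [ha.1]) hb.1)⟩
  have habs : ∀ z, |h z| ≤ 1 := fun z => by
    have ha := hf.mem z
    exact abs_le.2 ⟨by linarith [(hlo z).1, ha.1], by linarith [(hup z).1, ha.2]⟩
  have hms : Measurable fun z : ℝ × ℝ => h (z.1 - τ, z.2) := hm.comp (by fun_prop)
  have hfs : Measurable fun z : ℝ × ℝ => f (z.1 + τ, z.2) := hf.measurable.comp (by fun_prop)
  have hslice : ∀ x, Integrable (fun y => h (x, y)) μI := fun x =>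
    integrable_of_mem_Icc_s10 (hm.comp (by fun_prop)).aemeasurable 1
      (Eventually.of_forall fun _ => habs _)
  have hslice' : ∀ y, Integrable (fun x => h (x, y)) μI := fun x =>
    integrable_of_mem_Icc_s10 (hm.comp (by fun_prop)).aemeasurable 1
      (Eventually.of_forall fun _ => habs _)
  have hslice'' : ∀ y, Integrable (fun x => h (x - τ, y)) μI := fun x =>
    integrable_of_mem_Icc_s10 (hm.comp (by fun_prop)).aemeasurable 1
      (Eventually.of_forall fun _ => habs _)
  have hw : Rat2 (fun z => f z - (h z - h (z.1 - τ, z.2)) / 2) q₁ q₂ := by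
    refine ⟨(hf.measurable.sub ((hm.sub hms).div_const 2)).aemeasurable, fun z _ => ?_, ?_, ?_⟩
    · have ha := hup z
      have hb := hlo z
      have hc := (hup (z.1 - τ, z.2)).2
      have hd := (hlo (z.1 - τ, z.2)).2
      simp only [sub_add_cancel] at hc hd
      constructor <;> linarith [ha.1, hb.1]
    · filter_upwards [hf.rat.2.2.1, hf.rat.integrable.prod_right_ae] with x hx hxi
      have e : ∫ y, (h (x, y) - h (x - τ, y)) / 2 ∂μI = 0 := by
        rw [integral_div, integral_sub (hslice x) (hslice _)]
        have e1 := hmarg x; have e2 := hmarg (x - τ)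
        rw [marg₁] at e1 e2
        rw [e1, e2]; norm_num
      have e' : Integrable (fun y => (h (x, y) - h (x - τ, y)) / 2) μI :=
        ((hslice x).sub (hslice _)).div_const 2
      rw [hx, integral_sub hxi e', e, sub_zero]
    · filter_upwards [hf.rat.2.2.2, hf.rat.integrable.prod_left_ae] with y hy hyi
      have e : ∫ x, (h (x, y) - h (x - τ, y)) / 2 ∂μI = 0 := by
        rw [integral_div, integral_sub (hslice' y) (hslice'' y),
          integral_shift (g := fun x => h (x, y)) hτ fun x hx => h0 _ hx]
        norm_num
      have e' : Integrable (fun x => (h (x, y) - h (x - τ, y)) / 2) μI :=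
        ((hslice' y).sub (hslice'' y)).div_const 2
      rw [hy, integral_sub hyi e', e, sub_zero]
  have hfabs : ∀ z, |f z| ≤ 1 := fun z => by rw [abs_of_nonneg (hf.mem z).1]; exact (hf.mem z).2
  have hmul : ∀ a b : ℝ, |a| ≤ 1 → |b| ≤ 1 → |a * b| ≤ 1 := fun a b ha hb => by
    rw [abs_mul]; exact mul_le_one₀ ha (abs_nonneg _) hb
  have hi1 : Integrable (fun z => f z * h z) νI :=
    integrable_of_abs_le_one (hf.measurable.mul hm) fun z => hmul _ _ (hfabs _) (habs _)
  have hi2 : Integrable (fun z => f z * h (z.1 - τ, z.2)) νI :=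
    integrable_of_abs_le_one (hf.measurable.mul hms) fun z => hmul _ _ (hfabs _) (habs _)
  have hi3 : Integrable (fun z => f (z.1 + τ, z.2) * h z) νI :=
    integrable_of_abs_le_one (hfs.mul hm) fun z => hmul _ _ (hfabs _) (habs _)
  have hopt := hf.minimal _ hw
  have e1 : ∫ z, f z * ((f z - (h z - h (z.1 - τ, z.2)) / 2) - f z) ∂νI =
      ((∫ z, f z * h (z.1 - τ, z.2) ∂νI) - ∫ z, f z * h z ∂νI) / 2 := by
    rw [← integral_sub hi2 hi1, ← integral_div]
    congr 1; ext z; ring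
  have e2 : ∫ z, f z * h (z.1 - τ, z.2) ∂νI = ∫ z, f (z.1 + τ, z.2) * h z ∂νI := by
    rw [← integral_prod_shift (g := fun z => f (z.1 + τ, z.2) * h z) hτ (hfs.mul hm)
      (fun z => hmul _ _ (hfabs _) (habs _))
      fun z hz => by simp [h0 z hz]]
    simp
  have e3 : ∫ z, h z * (f z - f (z.1 + τ, z.2)) ∂νI =
      (∫ z, f z * h z ∂νI) - ∫ z, f (z.1 + τ, z.2) * h z ∂νI := by
    rw [← integral_sub hi1 hi3]
    congr 1; ext z; ring
  rw [e1, e2] at hopt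
  rw [e3]
  linarith

/-- A least-norm rationalization of a nondecreasing pair is nondecreasing in its first variable, up
to null sets. -/
lemma MinRat.ae_le_shift {f : ℝ × ℝ → ℝ} {q₁ q₂ : ℝ → ℝ} (hf : MinRat f q₁ q₂)
    (hq : MonotoneOn q₁ (Icc 0 1)) {τ : ℝ} (hτ : 0 ≤ τ) :
    ∀ᵐ z ∂νI, z.1 + τ ≤ 1 → f z ≤ f (z.1 + τ, z.2) := by
  set p : ℝ × ℝ → ℝ := fun z => max (f z - f (z.1 + τ, z.2)) 0 with hp
  set n : ℝ × ℝ → ℝ := fun z => max (f (z.1 + τ, z.2) - f z) 0 with hn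
  have hfs : Measurable fun z : ℝ × ℝ => f (z.1 + τ, z.2) := hf.measurable.comp (by fun_prop)
  have hpm : Measurable p := (hf.measurable.sub hfs).max measurable_const
  have hnm : Measurable n := (hfs.sub hf.measurable).max measurable_const
  have hpn : ∀ z, p z - n z = f z - f (z.1 + τ, z.2) := fun z => by
    simp only [hp, hn]
    rcases le_total (f z) (f (z.1 + τ, z.2)) with h | h
    · rw [max_eq_right (by linarith), max_eq_left (by linarith)]; ring
    · rw [max_eq_left (by linarith), max_eq_right (by linarith)]; ring
  have hpn0 : ∀ z, p z * n z = 0 := fun z => by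
    simp only [hp, hn]
    rcases le_total (f z) (f (z.1 + τ, z.2)) with h | h
    · rw [max_eq_right (by linarith), zero_mul]
    · rw [max_eq_right (a := f (z.1 + τ, z.2) - f z) (by linarith), mul_zero]
  have hpmem : ∀ z, p z ∈ Icc (0 : ℝ) 1 := fun z =>
    ⟨le_max_right _ _, max_le (by linarith [(hf.mem z).2, (hf.mem (z.1 + τ, z.2)).1]) zero_le_one⟩
  have hnmem : ∀ z, n z ∈ Icc (0 : ℝ) 1 := fun z =>
    ⟨le_max_right _ _, max_le (by linarith [(hf.mem z).1, (hf.mem (z.1 + τ, z.2)).2]) zero_le_one⟩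
  have hslice : ∀ g : ℝ × ℝ → ℝ, Measurable g → (∀ z, g z ∈ Icc (0 : ℝ) 1) → ∀ x,
      Integrable (fun y => g (x, y)) μI := fun g hg hg' x =>
    integrable_of_mem_Icc_s10 (hg.comp (by fun_prop)).aemeasurable 1 (Eventually.of_forall fun y => by
      rw [abs_of_nonneg (hg' _).1]; exact (hg' _).2)
  have hPmem : ∀ x, marg₁ p x ∈ Icc (0 : ℝ) 1 := fun x => integral_mem_Icc fun _ => hpmem _
  have hNmem : ∀ x, marg₁ n x ∈ Icc (0 : ℝ) 1 := fun x => integral_mem_Icc fun _ => hnmem _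
  have hPm : Measurable (marg₁ p) := hpm.stronglyMeasurable.integral_prod_right'.measurable
  have hNm : Measurable (marg₁ n) := hnm.stronglyMeasurable.integral_prod_right'.measurable
  set A : Set ℝ := Icc 0 (1 - τ) with hA
  set h : ℝ × ℝ → ℝ := fun z =>
    A.indicator 1 z.1 * (marg₁ n z.1 * p z - marg₁ p z.1 * n z) with hh
  have hhm : Measurable h :=
    ((measurable_one.indicator measurableSet_Icc).comp measurable_fst).mul
      (((hNm.comp measurable_fst).mul hpm).sub ((hPm.comp measurable_fst).mul hnm))
  have hh0 : ∀ z : ℝ × ℝ, z.1 ∉ A → h z = 0 := fun z hz => by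
    simp only [hh, indicator_of_notMem hz, zero_mul]
  have hhA : ∀ z : ℝ × ℝ, z.1 ∈ A → h z = marg₁ n z.1 * p z - marg₁ p z.1 * n z := fun z hz => by
    simp only [hh, indicator_of_mem hz, Pi.one_apply, one_mul]
  have hh1 : ∀ z, h z ≤ p z := fun z => by
    by_cases hz : z.1 ∈ A
    · rw [hhA z hz]
      have a := hpmem z; have b := hnmem z; have c := hPmem z.1; have d := hNmem z.1
      nlinarith [mul_nonneg c.1 b.1, mul_le_of_le_one_left a.1 d.2]
    · rw [hh0 z hz]; exact (hpmem z).1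
  have hh2 : ∀ z, -h z ≤ n z := fun z => by
    by_cases hz : z.1 ∈ A
    · rw [hhA z hz]
      have a := hpmem z; have b := hnmem z; have c := hPmem z.1; have d := hNmem z.1
      nlinarith [mul_nonneg d.1 a.1, mul_le_of_le_one_left b.1 c.2]
    · rw [hh0 z hz, neg_zero]; exact (hnmem z).1
  have hhmarg : ∀ x, marg₁ h x = 0 := fun x => by
    simp only [marg₁, hh]
    rw [integral_const_mul, integral_sub ((hslice p hpm hpmem x).const_mul _)
      ((hslice n hnm hnmem x).const_mul _), integral_const_mul, integral_const_mul]
    ring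
  have hle := hf.integral_mul_le hτ hhm hh0 hh1 hh2 hhmarg
  have hprod : ∀ z, h z * (f z - f (z.1 + τ, z.2)) =
      A.indicator 1 z.1 * (marg₁ n z.1 * p z ^ 2 + marg₁ p z.1 * n z ^ 2) := fun z => by
    rw [← hpn]
    simp only [hh]
    linear_combination (-(A.indicator 1 z.1 * (marg₁ n z.1 + marg₁ p z.1))) * hpn0 z
  have hnonneg : ∀ z, 0 ≤ h z * (f z - f (z.1 + τ, z.2)) := fun z => by
    rw [hprod]
    refine mul_nonneg (indicator_nonneg (fun _ _ => zero_le_one) _) (add_nonneg ?_ ?_)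
    · exact mul_nonneg (hNmem _).1 (sq_nonneg _)
    · exact mul_nonneg (hPmem _).1 (sq_nonneg _)
  have hint : Integrable (fun z => h z * (f z - f (z.1 + τ, z.2))) νI :=
    integrable_of_abs_le_one (hhm.mul (hf.measurable.sub hfs)) fun z => by
      rw [abs_mul]
      refine mul_le_one₀ (abs_le.2 ⟨?_, ?_⟩) (abs_nonneg _) (abs_le.2 ⟨?_, ?_⟩)
      · linarith [hh2 z, (hnmem z).2]
      · linarith [hh1 z, (hpmem z).2]
      · linarith [(hf.mem z).1, (hf.mem (z.1 + τ, z.2)).2]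
      · linarith [(hf.mem z).2, (hf.mem (z.1 + τ, z.2)).1]
  have hzero := (integral_eq_zero_iff_of_nonneg hnonneg hint).1
    (le_antisymm hle (integral_nonneg hnonneg))
  have hq1 : ∀ᵐ x ∂(volume : Measure ℝ), x ∈ Icc (0 : ℝ) 1 → q₁ x = marg₁ f x :=
    (ae_restrict_iff' measurableSet_Icc).1 hf.rat.2.2.1
  have hq1' : ∀ᵐ x ∂(volume : Measure ℝ), x + τ ∈ Icc (0 : ℝ) 1 → q₁ (x + τ) = marg₁ f (x + τ) :=
    (measurePreserving_add_right volume τ).quasiMeasurePreserving.ae hq1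
  refine ae_prod_of_ae_ae ?_ ?_
  · simp only [imp_iff_not_or]
    exact ((measurableSet_le (measurable_fst.add_const τ) measurable_const).compl.union
      (measurableSet_le hf.measurable hfs)).nullMeasurableSet
  filter_upwards [Measure.ae_ae_of_ae_prod hzero, ae_restrict_of_ae hq1, ae_restrict_of_ae hq1',
    ae_mem_unitInterval] with x hx hx1 hx2 hxI
  by_cases hxτ : x + τ ≤ 1
  swap
  · exact Eventually.of_forall fun y hy => absurd hy hxτ
  have hxA : x ∈ A := ⟨hxI.1, by linarith⟩
  have hxI' : x + τ ∈ Icc (0 : ℝ) 1 := ⟨by linarith [hxI.1], hxτ⟩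
  have hPN : marg₁ p x ≤ marg₁ n x := by
    have e : marg₁ p x - marg₁ n x = marg₁ f x - marg₁ f (x + τ) := by
      simp only [marg₁]
      rw [← integral_sub (hslice p hpm hpmem x) (hslice n hnm hnmem x),
        ← integral_sub (hslice f hf.measurable hf.mem x) (hslice f hf.measurable hf.mem _)]
      exact integral_congr_ae (Eventually.of_forall fun y => hpn (x, y))
    have := hq hxI hxI' (by linarith)
    rw [hx1 hxI, hx2 hxI'] at this
    linarith
  have hp0 : ∀ᵐ y ∂μI, p (x, y) = 0 := by
    by_cases hN : marg₁ n x = 0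
    · exact (integral_eq_zero_iff_of_nonneg (fun y => (hpmem (x, y)).1) (hslice p hpm hpmem x)).1
        (le_antisymm (hPN.trans_eq hN) (hPmem x).1)
    · filter_upwards [hx] with y hy
      have e := hprod (x, y)
      rw [hy, indicator_of_mem hxA] at e
      have a1 := mul_nonneg (hNmem x).1 (sq_nonneg (p (x, y)))
      have a2 := mul_nonneg (hPmem x).1 (sq_nonneg (n (x, y)))
      simp only [Pi.zero_apply, Pi.one_apply, one_mul] at e
      have a3 : marg₁ n x * p (x, y) ^ 2 = 0 := by linarith
      exact pow_eq_zero_iff two_ne_zero |>.1 ((mul_eq_zero.1 a3).resolve_left hN)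
  filter_upwards [hp0] with y hy _
  have := le_max_left (f (x, y) - f (x + τ, y)) 0
  have hy' : max (f (x, y) - f (x + τ, y)) 0 = 0 := hy
  linarith

/-- Extension of a function on the unit square by `1` above and by `0` below. -/
def extendSq (f : ℝ × ℝ → ℝ) (z : ℝ × ℝ) : ℝ :=
  open Classical in if z ∈ unitSq then f z else if 0 ≤ z then 1 else 0

lemma extendSq_mem {f : ℝ × ℝ → ℝ} (hf : ∀ z, f z ∈ Icc (0 : ℝ) 1) (z : ℝ × ℝ) :
    extendSq f z ∈ Icc (0 : ℝ) 1 := by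
  unfold extendSq
  split_ifs
  · exact hf z
  · norm_num
  · norm_num

lemma measurable_extendSq {f : ℝ × ℝ → ℝ} (hf : Measurable f) : Measurable (extendSq f) :=
  Measurable.ite measurableSet_unitSq hf
    (Measurable.ite measurableSet_Ici measurable_const measurable_const)

lemma extendSq_swap (f : ℝ × ℝ → ℝ) (z : ℝ × ℝ) :
    extendSq (fun z => f z.swap) z.swap = extendSq f z := by
  have h1 : z.swap ∈ unitSq ↔ z ∈ unitSq := by simp [mem_unitSq_iff, and_comm]
  have h2 : 0 ≤ z.swap ↔ 0 ≤ z := by simp [Prod.le_def, and_comm]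
  by_cases hz : z ∈ unitSq
  · exact (if_pos (h1.2 hz)).trans (if_pos hz).symm
  · by_cases h0 : 0 ≤ z
    · exact (if_neg (mt h1.1 hz)).trans <| (if_pos (h2.2 h0)).trans <|
        ((if_neg hz).trans (if_pos h0)).symm
    · exact (if_neg (mt h1.1 hz)).trans <| (if_neg (mt h2.1 h0)).trans <|
        ((if_neg hz).trans (if_neg h0)).symm

lemma extendSq_ae_le_fst {f : ℝ × ℝ → ℝ} (hf : ∀ z, f z ∈ Icc (0 : ℝ) 1) {τ : ℝ} (hτ : 0 ≤ τ)
    (h : ∀ᵐ z ∂νI, z.1 + τ ≤ 1 → f z ≤ f (z.1 + τ, z.2)) :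
    ∀ᵐ z ∂(volume : Measure (ℝ × ℝ)), extendSq f z ≤ extendSq f (z + (τ, 0)) := by
  rw [← volume_restrict_unitSq, ae_restrict_iff' measurableSet_unitSq] at h
  filter_upwards [h] with z hz
  have hz2 : z + (τ, 0) = (z.1 + τ, z.2) := by ext <;> simp
  have hpos : 0 ≤ z → 0 ≤ z + (τ, 0) := fun h0 => add_nonneg h0 (Prod.mk_le_mk.2 ⟨hτ, le_rfl⟩)
  have hmem := (extendSq_mem hf z).2
  by_cases h0 : 0 ≤ z
  · by_cases hs : z + (τ, 0) ∈ unitSq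
    · have hs' : z ∈ unitSq :=
        ⟨h0, (le_add_of_nonneg_right (Prod.mk_le_mk.2 ⟨hτ, le_rfl⟩)).trans hs.2⟩
      simp only [extendSq, if_pos hs, if_pos hs', hz2]
      rw [hz2, mem_unitSq_iff] at hs
      exact hz hs' hs.1.2
    · refine hmem.trans_eq ?_
      simp only [extendSq, if_neg hs, if_pos (hpos h0)]
  · have h1 : z ∉ unitSq := fun h => h0 h.1
    refine le_trans (le_of_eq ?_) (extendSq_mem hf _).1
    simp only [extendSq, if_neg h1, if_neg h0]

lemma MinRat.extendSq_ae_le {f : ℝ × ℝ → ℝ} {q₁ q₂ : ℝ → ℝ} (hf : MinRat f q₁ q₂)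
    (hq₁ : MonotoneOn q₁ (Icc 0 1)) (hq₂ : MonotoneOn q₂ (Icc 0 1)) {v : ℝ × ℝ} (hv : 0 ≤ v) :
    ∀ᵐ z ∂(volume : Measure (ℝ × ℝ)), extendSq f z ≤ extendSq f (z + v) := by
  have h1 := extendSq_ae_le_fst hf.mem hv.1 (hf.ae_le_shift hq₁ hv.1)
  have h2 := extendSq_ae_le_fst hf.swap.mem hv.2 (hf.swap.ae_le_shift hq₂ hv.2)
  have hswap : MeasurePreserving Prod.swap (volume : Measure (ℝ × ℝ)) volume :=
    Measure.measurePreserving_swap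
  have h3 := (measurePreserving_add_right volume ((v.1, 0) : ℝ × ℝ)).quasiMeasurePreserving.ae
    (hswap.quasiMeasurePreserving.ae h2)
  filter_upwards [h1, h3] with z hz1 hz3
  refine hz1.trans ?_
  rw [extendSq_swap] at hz3
  refine hz3.trans_eq ?_
  rw [← extendSq_swap f (z + v)]
  congr 1
  ext <;> simp [add_comm]

/-- A function that increases almost everywhere along each nonnegative translation has a monotone
version. -/
lemma exists_monoUnit_of_ae_le_add {g : ℝ × ℝ → ℝ} (hgm : Measurable g)
    (hg : ∀ z, g z ∈ Icc (0 : ℝ) 1)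
    (hle : ∀ v : ℝ × ℝ, 0 ≤ v → ∀ᵐ z ∂(volume : Measure (ℝ × ℝ)), g z ≤ g (z + v)) :
    ∃ F, MonoUnit F ∧ g =ᵐ[volume] F := by
  have hbd : ∀ z, ‖g z‖ ≤ 1 := fun z => by
    rw [Real.norm_eq_abs, abs_of_nonneg (hg z).1]; exact (hg z).2
  set a : ℝ × ℝ → ℕ → ℝ := fun z n => ⨍ y in Metric.closedBall z (1 / ((n : ℝ) + 1)), g y with ha
  have hgi : ∀ (z : ℝ × ℝ) (r : ℝ), IntegrableOn g (Metric.closedBall z r) := fun z r => by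
    refine Measure.integrableOn_of_bounded (M := 1) ?_ hgm.aestronglyMeasurable
      (Eventually.of_forall hbd)
    exact measure_closedBall_lt_top.ne
  have hamem : ∀ z n, a z n ∈ Icc (0 : ℝ) 1 := fun z n => by
    simp only [ha]
    rw [setAverage_eq]
    have hr : (0 : ℝ) < 1 / ((n : ℝ) + 1) := by positivity
    have hvol : 0 < volume.real (Metric.closedBall z (1 / ((n : ℝ) + 1))) :=
      ENNReal.toReal_pos (Metric.measure_closedBall_pos _ _ hr).ne' measure_closedBall_lt_top.ne
    have h1 := norm_setIntegral_le_of_norm_le_const (μ := volume) (f := g) (C := 1)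
      (s := Metric.closedBall z (1 / ((n : ℝ) + 1))) measure_closedBall_lt_top
      fun x _ => hbd x
    rw [one_mul, Real.norm_eq_abs] at h1
    refine ⟨smul_nonneg (inv_nonneg.2 hvol.le) (integral_nonneg fun z => (hg z).1), ?_⟩
    rw [smul_eq_mul, inv_mul_le_one₀ hvol]
    exact (le_abs_self _).trans h1
  have hamono : ∀ n, Monotone fun z => a z n := fun n z w hzw => by
    obtain ⟨v, rfl⟩ : ∃ v, w = z + v := ⟨w - z, by abel⟩
    have hv : 0 ≤ v := by simpa using hzw
    simp only [ha]
    set r := 1 / ((n : ℝ) + 1)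
    have hpre : (fun y => y + v) ⁻¹' Metric.closedBall (z + v) r = Metric.closedBall z r := by
      ext y; simp
    have hmp := measurePreserving_add_right (volume : Measure (ℝ × ℝ)) v
    have hint : ∫ y in Metric.closedBall (z + v) r, g y =
        ∫ y in Metric.closedBall z r, g (y + v) := by
      rw [← hpre, hmp.setIntegral_preimage_emb (measurableEmbedding_addRight v)]
    have hvol : volume.real (Metric.closedBall (z + v) r) =
        volume.real (Metric.closedBall z r) := by
      rw [← hpre, measureReal_def, measureReal_def,
        hmp.measure_preimage Metric.isClosed_closedBall.measurableSet.nullMeasurableSet]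
    rw [setAverage_eq, setAverage_eq, hint, hvol]
    refine smul_le_smul_of_nonneg_left ?_ (inv_nonneg.2 measureReal_nonneg)
    refine integral_mono_ae (hgi z r) ?_ (ae_restrict_of_ae (hle v hv))
    refine Measure.integrableOn_of_bounded (M := 1) measure_closedBall_lt_top.ne
      (hgm.comp (measurable_add_const v)).aestronglyMeasurable (Eventually.of_forall fun z => hbd _)
  have hbA : ∀ z, IsBoundedUnder (· ≤ ·) atTop (a z) := fun z =>
    isBoundedUnder_of ⟨1, fun n => (hamem z n).2⟩
  have hbB : ∀ z, IsBoundedUnder (· ≥ ·) atTop (a z) := fun z =>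
    isBoundedUnder_of ⟨0, fun n => (hamem z n).1⟩
  refine ⟨fun z => limsup (a z) atTop, ⟨fun z w hzw => ?_, fun z => ⟨?_, ?_⟩⟩, ?_⟩
  · exact limsup_le_limsup (Eventually.of_forall fun n => hamono n hzw)
      (hbB z).isCoboundedUnder_le (hbA w)
  · exact le_limsup_of_frequently_le (Frequently.of_forall fun n => (hamem z n).1) (hbA z)
  · exact limsup_le_of_le (hbB z).isCoboundedUnder_le (Eventually.of_forall fun n => (hamem z n).2)
  · have hloc : LocallyIntegrable g (volume : Measure (ℝ × ℝ)) := fun z =>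
      ⟨_, Metric.closedBall_mem_nhds z one_pos, hgi z 1⟩
    filter_upwards [IsUnifLocDoublingMeasure.ae_tendsto_average volume hloc 1] with z hz
    refine (Tendsto.limsup_eq (hz (fun _ => z) (fun n : ℕ => 1 / ((n : ℝ) + 1)) ?_ ?_)).symm
    · exact tendsto_nhdsWithin_iff.2 ⟨tendsto_one_div_add_atTop_nhds_zero_nat,
        Eventually.of_forall fun n => mem_Ioi.2 (by positivity)⟩
    · exact Eventually.of_forall fun n => Metric.mem_closedBall_self (by positivity)

/-- A rationalizable pair of nondecreasing functions has a nondecreasing rationalization. -/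
lemma Rat2.exists_monotone {f : ℝ × ℝ → ℝ} {q₁ q₂ : ℝ → ℝ} (h : Rat2 f q₁ q₂)
    (hq₁ : MonotoneOn q₁ (Icc 0 1)) (hq₂ : MonotoneOn q₂ (Icc 0 1)) :
    ∃ F, MonoUnit F ∧ Rat2 F q₁ q₂ := by
  obtain ⟨g, hg⟩ := h.exists_minRat
  obtain ⟨F, hF, hgF⟩ := exists_monoUnit_of_ae_le_add (measurable_extendSq hg.measurable)
    (extendSq_mem hg.mem) fun v hv => hg.extendSq_ae_le hq₁ hq₂ hv
  refine ⟨F, hF, hg.rat.congr (fun z _ => hF.mem z) ?_⟩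
  rw [← volume_restrict_unitSq]
  filter_upwards [ae_restrict_of_ae hgF, ae_restrict_mem measurableSet_unitSq] with z hz hzS
  rw [← hz]
  exact (if_pos hzS).symm

/-- every extreme point of the set of rationalizable pairs subject to one
linear inequality constraint is rationalized by a mixture `λ·1_A + (1−λ)·1_{A'}` of
indicators of nested up-sets `A' ⊆ A` differing by at most a rectangle, and is uniquely
rationalized among all monotone functions. -/
theorem stmt10 (ψ₁ ψ₂ : ℝ → ℝ)
    (hm1 : Measurable ψ₁) (hm2 : Measurable ψ₂)
    (hb1 : ∃ C : ℝ, ∀ᵐ t ∂(volume.restrict (Set.Icc (0 : ℝ) 1)), |ψ₁ t| ≤ C)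
    (hb2 : ∃ C : ℝ, ∀ᵐ t ∂(volume.restrict (Set.Icc (0 : ℝ) 1)), |ψ₂ t| ≤ C)
    (η : ℝ)
    (q : (ℝ → ℝ) × (ℝ → ℝ))
    (hq : ExtremePt2
      {p | p ∈ Q2 ∧
        (∫ t in Set.Icc (0 : ℝ) 1, p.1 t * ψ₁ t) +
          (∫ t in Set.Icc (0 : ℝ) 1, p.2 t * ψ₂ t) ≤ η} q) :
    (∃ (A A' : Set (ℝ × ℝ)) (lam a b c d : ℝ),
      UpSet2 A ∧ UpSet2 A' ∧ A' ⊆ A ∧ lam ∈ Set.Icc (0 : ℝ) 1 ∧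
      volume (((A \ A') \ (Set.Icc a b ×ˢ Set.Icc c d)) ∪
        ((Set.Icc a b ×ˢ Set.Icc c d) \ (A \ A'))) = 0 ∧
      Rat2 (fun x => lam * A.indicator 1 x + (1 - lam) * A'.indicator 1 x) q.1 q.2) ∧
    (∀ f f' : ℝ × ℝ → ℝ,
      (∀ x ∈ unitSq, ∀ y ∈ unitSq, x ≤ y → f x ≤ f y) →
      (∀ x ∈ unitSq, ∀ y ∈ unitSq, x ≤ y → f' x ≤ f' y) →
      Rat2 f q.1 q.2 → Rat2 f' q.1 q.2 →
      f =ᵐ[volume.restrict unitSq] f') := by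
  have hψ₁ : EssBdd ψ₁ := ⟨hm1, hb1⟩
  have hψ₂ : EssBdd ψ₂ := ⟨hm2, hb2⟩
  have hq' : ExtremePt2 (constrainedQ2 ψ₁ ψ₂ η) q := hq
  refine ⟨?_, fun f f' hf hf' hR hR' => ?_⟩
  · obtain ⟨f, hf⟩ := hq.1.1.2.2
    obtain ⟨F, hF, hR⟩ := hf.exists_monotone hq.1.1.1.1 hq.1.1.2.1.1
    obtain ⟨m₁, h₁⟩ := hq'.exists_marg₁_eq hψ₁ hψ₂ hF hR
    obtain ⟨m₂, h₂⟩ := hq'.swap.exists_marg₁_eq hψ₂ hψ₁ hF.swap hR.swap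
    exact exists_upSets_of_fracSlices hF hR h₁ h₂
  · obtain ⟨F, hF, hFR, hfF⟩ := hR.exists_monoUnit hf
    obtain ⟨G, hG, hGR, hfG⟩ := hR'.exists_monoUnit hf'
    rw [volume_restrict_unitSq]
    exact hfF.trans ((hq'.monoUnit_ae_eq hψ₁ hψ₂ hF hG hFR hGR).trans hfG.symm)
end
end
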